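/- Among the 298 combinatorially inequivalent orientation-reversing gluing patterns of the faces of the octahedron, there are exactly 2 patterns whose non-sphere vertex-link data consists of one genus-2 surface and one torus (one vertex class with link of Euler characteristic −2, one with Euler characteristic 0, and all other vertex links 2-spheres), and the quotient spaces X(φ) of these two patterns are not homeomorphic. -/

import Mathlib

/-! Combinatorial model of the octahedron and of orientation-reversing gluing
patterns of its faces, following Heard–Pervova–Petronio. -/

/-- Vertices of the octahedron `±e_i`, encoded as a pair (axis, sign). -/
abbrev OctVertex : Type := Fin 3 × Bool

/-- Faces of the octahedron: a choice of a sign for each coordinate axis;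
the face `F` has vertex set `{(i, F i) : i ∈ Fin 3}`. -/
abbrev OctFace : Type := Fin 3 → Bool

/-- The parity of a face.  The cyclic order (axis 0, axis 1, axis 2) of the vertices of
a face `F` agrees with the cyclic order induced by the outward orientation of the
boundary of the solid octahedron if and only if `faceSign F = true`. -/
def faceSign (F : OctFace) : Bool := Bool.xor (F 0) (Bool.xor (F 1) (F 2))

/-- `IsGluing σ π` says that the fixed-point-free involution `σ` of the set of faces,
together with the face identifications `π` (the bijection `φ_F` from the vertices of `F`
to those of `σ F` sends the vertex of `F` on axis `i` to the vertex of `σ F` on axis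
`π F i`), is an orientation-reversing gluing pattern: `φ_{σ F} = φ_F⁻¹` and every `φ_F`
reverses the cyclic orderings induced by the boundary orientation (a bijection
`F → σ F` given by `π` reverses them iff `sign (π) · faceSign F · faceSign (σ F) = -1`). -/
def IsGluing (σ : Equiv.Perm OctFace) (π : OctFace → Equiv.Perm (Fin 3)) : Prop :=
  (∀ F, σ (σ F) = F) ∧ (∀ F, σ F ≠ F) ∧ (∀ F, π (σ F) = (π F)⁻¹) ∧
    (∀ F, Equiv.Perm.sign (π F) = 1 ↔ faceSign F ≠ faceSign (σ F))

instance : DecidablePred fun p : Equiv.Perm OctFace × (OctFace → Equiv.Perm (Fin 3)) =>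
    IsGluing p.1 p.2 := fun p => by unfold IsGluing; infer_instance

/-- An orientation-reversing gluing pattern of the faces of the octahedron. -/
abbrev Gluing : Type :=
  {p : Equiv.Perm OctFace × (OctFace → Equiv.Perm (Fin 3)) // IsGluing p.1 p.2}

/-- The involution on faces underlying a gluing pattern. -/
def Gluing.face (g : Gluing) : Equiv.Perm OctFace := g.1.1

/-- The face identifications of a gluing pattern, as permutations of the axes. -/
def Gluing.axisMap (g : Gluing) : OctFace → Equiv.Perm (Fin 3) := g.1.2

/-- The action of the symmetry of the octahedron given by the signed axis permutation
`(ρ, ε)` (sending the vertex `(i, b)` to `(ρ i, xor b (ε i))`) on faces. -/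
def symMapFace (ρ : Equiv.Perm (Fin 3)) (ε : Fin 3 → Bool) (F : OctFace) : OctFace :=
  fun j => Bool.xor (F (ρ⁻¹ j)) (ε (ρ⁻¹ j))

/-- Two gluing patterns are combinatorially equivalent if some symmetry of the
octahedron conjugates one into the other. -/
def EquivGluing (g h : Gluing) : Prop :=
  ∃ (ρ : Equiv.Perm (Fin 3)) (ε : Fin 3 → Bool),
    (∀ F, h.face (symMapFace ρ ε F) = symMapFace ρ ε (g.face F)) ∧
    (∀ F, h.axisMap (symMapFace ρ ε F) = ρ * g.axisMap F * ρ⁻¹)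

/-- The combinatorial equivalence class (orbit under the symmetry group) of a gluing. -/
def orbit (g : Gluing) : Set Gluing := {h | EquivGluing g h}

/-- The identifications induced by a gluing pattern on the vertices of the octahedron:
the vertex of `F` on axis `i` is glued to the corresponding vertex of `face F`. -/
def vtxRel (g : Gluing) (v w : OctVertex) : Prop :=
  ∃ (F : OctFace) (i : Fin 3),
    v = (i, F i) ∧ w = (g.axisMap F i, g.face F (g.axisMap F i))

/-- The equivalence relation on vertices generated by the face identifications. -/
def vtxSetoid (g : Gluing) : Setoid OctVertex := Relation.EqvGen.setoid (vtxRel g)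

/-- The number of vertex classes of a gluing pattern. -/
noncomputable def vtxCount (g : Gluing) : ℕ := Nat.card (Quotient (vtxSetoid g))

/-- An edge-end (corner) of the octahedron: an ordered pair of vertices lying on
distinct axes; it represents the edge between them together with the choice of the
first vertex as its endpoint.  Edge-ends correspond to the corners of the
quadrilateral vertex links. -/
abbrev EdgeEnd : Type := {p : OctVertex × OctVertex // p.1.1 ≠ p.2.1}

/-- The identifications induced by a gluing pattern on edge-ends: an edge-end contained
in the face `F` is glued to the corresponding edge-end of `face F`. -/
def endRel (g : Gluing) (p q : EdgeEnd) : Prop :=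
  ∃ (F : OctFace) (i j : Fin 3), i ≠ j ∧ p.1 = ((i, F i), (j, F j)) ∧
    q.1 = ((g.axisMap F i, g.face F (g.axisMap F i)),
           (g.axisMap F j, g.face F (g.axisMap F j)))

/-- The equivalence relation on edge-ends generated by the face identifications.
Its classes are the vertices of the quadrangulated link surfaces of the vertex
classes. -/
def endSetoid (g : Gluing) : Setoid EdgeEnd := Relation.EqvGen.setoid (endRel g)

/-- The relation on edge-ends generating the edge identifications: face identifications
together with forgetting the choice of endpoint. -/
def edgeRel (g : Gluing) (p q : EdgeEnd) : Prop :=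
  endRel g p q ∨ q.1 = (p.1.2, p.1.1)

/-- The equivalence relation whose classes are the edge classes of a gluing pattern. -/
def edgeSetoid (g : Gluing) : Setoid EdgeEnd := Relation.EqvGen.setoid (edgeRel g)

/-- The number of edge classes of a gluing pattern. -/
noncomputable def edgeCount (g : Gluing) : ℕ := Nat.card (Quotient (edgeSetoid g))

/-- The number of vertices of the octahedron lying in the vertex class `c`; this is
the number of quadrilaterals tiling the link surface of `c`. -/
noncomputable def classSize (g : Gluing) (c : Quotient (vtxSetoid g)) : ℕ :=
  Nat.card {v : OctVertex // Quotient.mk (vtxSetoid g) v = c}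

/-- The number of vertices of the quadrangulated link surface of the vertex class `c`:
the number of classes of edge-ends whose endpoint lies in `c`. -/
noncomputable def cornerCount (g : Gluing) (c : Quotient (vtxSetoid g)) : ℕ :=
  Nat.card {q : Quotient (endSetoid g) //
    ∃ p : EdgeEnd, Quotient.mk (endSetoid g) p = q ∧ Quotient.mk (vtxSetoid g) p.1.1 = c}

/-- The Euler characteristic of the link surface of the vertex class `c`: the link is
tiled by `classSize g c` quadrilaterals, with `2 * classSize g c` edges and
`cornerCount g c` vertices, so `χ = cornerCount - 2 * classSize + classSize`. -/
noncomputable def linkChi (g : Gluing) (c : Quotient (vtxSetoid g)) : ℤ :=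
  (cornerCount g c : ℤ) - (classSize g c : ℤ)

/-- All vertex links are 2-spheres: the quotient space is a closed manifold. -/
def AllLinksSphere (g : Gluing) : Prop := ∀ c, linkChi g c = 2

/-- The non-sphere vertex-link data consists of a single torus. -/
def LinksOneTorus (g : Gluing) : Prop :=
  (∀ c, linkChi g c = 2 ∨ linkChi g c = 0) ∧
    Nat.card {c : Quotient (vtxSetoid g) // linkChi g c = 0} = 1

/-- The non-sphere vertex-link data consists of two tori. -/
def LinksTwoTori (g : Gluing) : Prop :=
  (∀ c, linkChi g c = 2 ∨ linkChi g c = 0) ∧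
    Nat.card {c : Quotient (vtxSetoid g) // linkChi g c = 0} = 2

/-- The non-sphere vertex-link data consists of a single genus-2 surface. -/
def LinksGenusTwo (g : Gluing) : Prop :=
  (∀ c, linkChi g c = 2 ∨ linkChi g c = -2) ∧
    Nat.card {c : Quotient (vtxSetoid g) // linkChi g c = -2} = 1

/-- The non-sphere vertex-link data consists of one genus-2 surface and one torus. -/
def LinksGenusTwoTorus (g : Gluing) : Prop :=
  (∀ c, linkChi g c = 2 ∨ linkChi g c = 0 ∨ linkChi g c = -2) ∧
    Nat.card {c : Quotient (vtxSetoid g) // linkChi g c = 0} = 1 ∧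
    Nat.card {c : Quotient (vtxSetoid g) // linkChi g c = -2} = 1

/-- The non-sphere vertex-link data consists of a single genus-3 surface. -/
def LinksGenusThree (g : Gluing) : Prop :=
  (∀ c, linkChi g c = 2 ∨ linkChi g c = -4) ∧
    Nat.card {c : Quotient (vtxSetoid g) // linkChi g c = -4} = 1

/-! The geometric realization: the solid octahedron in `ℝ³` and the quotient
space `X(φ)` of a gluing pattern `φ`. -/

/-- The point `±e_i` of `ℝ³` corresponding to a vertex of the octahedron. -/
def vertexPt (v : OctVertex) : Fin 3 → ℝ :=
  fun j => if j = v.1 then (if v.2 then 1 else -1) else 0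

/-- The solid octahedron: the convex hull of `{±e₁, ±e₂, ±e₃}` in `ℝ³`. -/
def SolidOcta : Set (Fin 3 → ℝ) := convexHull ℝ (Set.range vertexPt)

theorem vertexPt_mem_solidOcta (v : OctVertex) : vertexPt v ∈ SolidOcta :=
  subset_convexHull ℝ _ (Set.mem_range_self v)

/-- The gluing relation on the solid octahedron: the point of the closed triangular face
of `F` with barycentric coordinates `w` is glued to the point of the face of
`face F` with the corresponding barycentric coordinates, i.e. the faces
are identified via the affine extensions of the combinatorial identifications. -/
def glueRel (g : Gluing) (x y : SolidOcta) : Prop :=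
  ∃ (F : OctFace) (w : Fin 3 → ℝ), (∀ i, 0 ≤ w i) ∧ (∑ i, w i) = 1 ∧
    (x : Fin 3 → ℝ) = ∑ i, w i • vertexPt (i, F i) ∧
    (y : Fin 3 → ℝ) = ∑ i, w i • vertexPt (g.axisMap F i, g.face F (g.axisMap F i))

/-- The equivalence relation on the solid octahedron generated by the affine face
identifications of a gluing pattern. -/
def glueSetoid (g : Gluing) : Setoid SolidOcta := Relation.EqvGen.setoid (glueRel g)

/-- The quotient space `X(φ)` of the solid octahedron by the gluing pattern `φ`,
with the quotient topology. -/
abbrev XSpace (g : Gluing) : Type := Quotient (glueSetoid g)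

section Part1

open Filter Topology

section GenericTopology

/-- Locally constant functions on preconnected sets are constant. -/
theorem eq_of_locConst {α Y : Type*} [TopologicalSpace α] {D : Set α} (hD : IsPreconnected D)
    (f : α → Y) (hf : ∀ y ∈ D, ∀ᶠ y' in 𝓝[D] y, f y' = f y) {x y : α} (hx : x ∈ D) (hy : y ∈ D) :
    f x = f y := by
  letI : TopologicalSpace Y := ⊥
  haveI : DiscreteTopology Y := ⟨rfl⟩
  refine hD.constant (f := f) ?_ hx hy
  intro z hz
  unfold ContinuousWithinAt
  rw [nhds_discrete, tendsto_pure]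
  exact hf z hz

/-- A germ cocycle on a subset `D`. -/
def CocOn {α G : Type*} [TopologicalSpace α] [Group G] (c : α → α → G) (D : Set α) : Prop :=
  ∀ y ∈ D, ∀ᶠ y' in 𝓝[D] y, ∀ᶠ z in 𝓝[D] y', c y z = c y y' * c y' z

/-- A trivialization of a germ cocycle on a subset `D`. -/
def TrivOn {α G : Type*} [TopologicalSpace α] [Group G] (c : α → α → G) (D : Set α)
    (h : α → G) : Prop :=
  ∀ y ∈ D, ∀ᶠ y' in 𝓝[D] y, c y y' = (h y)⁻¹ * h y'

variable {α G : Type*} [TopologicalSpace α] [Group G]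

theorem TrivOn.mono {c : α → α → G} {D D' : Set α} {h : α → G} (H : TrivOn c D h)
    (hs : D' ⊆ D) : TrivOn c D' h := fun y hy =>
  (H y (hs hy)).filter_mono (nhdsWithin_mono _ hs)

theorem CocOn.mono {c : α → α → G} {D D' : Set α} (H : CocOn c D)
    (hs : D' ⊆ D) : CocOn c D' := fun y hy => by
  refine ((H y (hs hy)).filter_mono (nhdsWithin_mono _ hs)).mono ?_
  intro y' h
  exact h.filter_mono (nhdsWithin_mono _ hs)

theorem CocOn.self {c : α → α → G} {D : Set α} (H : CocOn c D) {y : α} (hy : y ∈ D) :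
    c y y = 1 := by
  have h1 := (H y hy).self_of_nhdsWithin hy
  have h2 := h1.self_of_nhdsWithin hy
  simpa using h2

/-- Pullback of a cocycle. -/
theorem CocOn.comp {β : Type*} [TopologicalSpace β] {c : α → α → G} {D : Set α}
    (H : CocOn c D) {f : β → α} {D' : Set β} (hf : ContinuousOn f D') (hm : Set.MapsTo f D' D) :
    CocOn (fun x y => c (f x) (f y)) D' := by
  have key : ∀ y ∈ D', Tendsto f (𝓝[D'] y) (𝓝[D] (f y)) := fun y hy =>
    (hf y hy).tendsto_nhdsWithin hm
  intro y hy
  filter_upwards [(key y hy).eventually (H _ (hm hy)), self_mem_nhdsWithin] with y' h1 hy'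
  exact (key y' hy').eventually h1

/-- Local trivializations. -/
theorem CocOn.local {c : α → α → G} {D : Set α} (H : CocOn c D) {y : α} (hy : y ∈ D) :
    ∃ U : Set α, IsOpen U ∧ y ∈ U ∧ TrivOn c (U ∩ D) (c y) ∧
      ∀ a ∈ U ∩ D, ∀ᶠ b in 𝓝[D] a, c a b = (c y a)⁻¹ * c y b := by
  obtain ⟨U, h, hU, hyU⟩ := eventually_nhds_iff.1 (eventually_nhdsWithin_iff.1 (H y hy))
  have key : ∀ a ∈ U ∩ D, ∀ᶠ b in 𝓝[D] a, c a b = (c y a)⁻¹ * c y b := by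
    intro a ha
    filter_upwards [h a ha.1 ha.2] with b hb
    rw [hb]; group
  exact ⟨U, hU, hyU, fun a ha => (key a ha).filter_mono (nhdsWithin_mono _ Set.inter_subset_right),
    key⟩

/-- Two trivializations differ by a constant. -/
theorem TrivOn.unique {c : α → α → G} {D : Set α} {h k : α → G} (hD : IsPreconnected D)
    (H : TrivOn c D h) (K : TrivOn c D k) {x y : α} (hx : x ∈ D) (hy : y ∈ D) :
    h x * (k x)⁻¹ = h y * (k y)⁻¹ := by
  refine eq_of_locConst hD (fun x => h x * (k x)⁻¹) ?_ hx hy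
  intro z hz
  filter_upwards [H z hz, K z hz] with w h1 h2
  have : (h z)⁻¹ * h w = (k z)⁻¹ * k w := by rw [← h1, ← h2]
  have h3 : h w = h z * ((k z)⁻¹ * k w) := by rw [← this]; group
  rw [h3]; group

/-- Cocycles on an interval are trivial. -/
theorem CocOn.interval {c : ℝ → ℝ → G} (H : CocOn c (Set.Icc 0 1)) :
    ∃ h : ℝ → G, h 0 = 1 ∧ TrivOn c (Set.Icc 0 1) h := by
  have main : ∃ h : ℝ → G, TrivOn c (Set.Icc 0 1) h := by
    have key := eq_of_locConst (isPreconnected_Icc (a := (0:ℝ)) (b := 1))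
      (fun t => ∃ h : ℝ → G, TrivOn c (Set.Icc 0 t) h) ?_
      (x := 0) (y := 1) (by simp) (by simp)
    · rw [← key]
      refine ⟨fun _ => 1, ?_⟩
      intro y hy
      have hy0 : y = 0 := le_antisymm hy.2 hy.1
      subst hy0
      have : Set.Icc (0:ℝ) 0 = {0} := by simp
      rw [this, nhdsWithin_singleton]
      simp [H.self (y := 0) (by simp)]
    · intro t0 ht0
      obtain ⟨U, hU, hyU, hk, -⟩ := H.local ht0
      obtain ⟨ε, hε, hball⟩ := Metric.isOpen_iff.1 hU t0 hyU
      have step : ∀ t ∈ Metric.ball t0 ε ∩ Set.Icc 0 1, ∀ t1 ∈ Metric.ball t0 ε ∩ Set.Icc 0 1,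
          (∃ h : ℝ → G, TrivOn c (Set.Icc 0 t1) h) → ∃ h : ℝ → G, TrivOn c (Set.Icc 0 t) h := by
        rintro t ht t1 ht1 ⟨h, hh⟩
        rcases le_or_gt t t1 with hle | hlt
        · exact ⟨h, hh.mono (Set.Icc_subset_Icc_right hle)⟩
        set k := c t0 with hkdef
        have hsub : Set.Icc t1 t ⊆ U ∩ Set.Icc 0 1 := by
          intro s hs
          refine ⟨hball ?_, ht1.2.1.trans hs.1, hs.2.trans ht.2.2⟩
          have h1 := ht1.1; have h2 := ht.1
          rw [Metric.mem_ball, Real.dist_eq, abs_lt] at h1 h2 ⊢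
          constructor <;> linarith [hs.1, hs.2]
        have hk' := hk.mono hsub
        refine ⟨fun s => if s ≤ t1 then h s else h t1 * (k t1)⁻¹ * k s, ?_⟩
        intro y hy
        have hun : Set.Icc 0 t = Set.Icc 0 t1 ∪ Set.Icc t1 t :=
          (Set.Icc_union_Icc_eq_Icc ht1.2.1 hlt.le).symm
        rcases lt_trichotomy y t1 with hy1 | hy1 | hy1
        · have e1 : ∀ᶠ s in 𝓝[Set.Icc 0 t] y, s < t1 :=
            (Filter.Eventually.filter_mono nhdsWithin_le_nhds (eventually_lt_nhds hy1))
          have e2 : ∀ᶠ s in 𝓝[Set.Icc 0 t] y, s ∈ Set.Icc 0 t1 → c y s = (h y)⁻¹ * h s :=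
            (eventually_nhdsWithin_iff.1 (hh y ⟨hy.1, hy1.le⟩)).filter_mono nhdsWithin_le_nhds
          filter_upwards [e1, e2, self_mem_nhdsWithin] with s h1 h2 h3
          rw [h2 ⟨h3.1, h1.le⟩, if_pos hy1.le, if_pos h1.le]
        · subst hy1
          have e1 := eventually_nhdsWithin_iff.1 (hh y ⟨hy.1, le_rfl⟩)
          have e2 := eventually_nhdsWithin_iff.1 (hk' y ⟨le_rfl, hlt.le⟩)
          filter_upwards [e1.filter_mono nhdsWithin_le_nhds, e2.filter_mono nhdsWithin_le_nhds,
            self_mem_nhdsWithin] with s h1 h2 h3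
          rw [if_pos le_rfl]
          split_ifs with h4
          · exact h1 ⟨h3.1, h4⟩
          · rw [h2 ⟨(not_le.1 h4).le, h3.2⟩]; group
        · have e1 : ∀ᶠ s in 𝓝[Set.Icc 0 t] y, t1 < s :=
            (Filter.Eventually.filter_mono nhdsWithin_le_nhds (eventually_gt_nhds hy1))
          have e2 : ∀ᶠ s in 𝓝[Set.Icc 0 t] y, s ∈ Set.Icc t1 t → c y s = (k y)⁻¹ * k s :=
            (eventually_nhdsWithin_iff.1 (hk' y ⟨hy1.le, hy.2⟩)).filter_mono nhdsWithin_le_nhds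
          filter_upwards [e1, e2, self_mem_nhdsWithin] with s h1 h2 h3
          rw [h2 ⟨h1.le, h3.2⟩, if_neg (not_le.2 hy1), if_neg (not_le.2 h1)]; group
      have hmem : ∀ᶠ t in 𝓝[Set.Icc 0 1] t0, t ∈ Metric.ball t0 ε ∩ Set.Icc 0 1 :=
        inter_mem (nhdsWithin_le_nhds (Metric.ball_mem_nhds t0 hε)) self_mem_nhdsWithin
      filter_upwards [hmem] with t ht
      have ht00 : t0 ∈ Metric.ball t0 ε ∩ Set.Icc 0 1 := ⟨Metric.mem_ball_self hε, ht0⟩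
      exact propext ⟨step t0 ht00 t ht, step t ht t0 ht00⟩
  obtain ⟨h, hh⟩ := main
  refine ⟨fun s => (h 0)⁻¹ * h s, by simp, ?_⟩
  intro y hy
  filter_upwards [hh y hy] with s hs
  rw [hs]; group

/-- Cocycles on star-shaped sets are trivial. -/
theorem CocOn.star {E : Type*} [NormedAddCommGroup E] [NormedSpace ℝ E] {c : E → E → G}
    {D : Set E} {o : E} (H : CocOn c D) (hst : ∀ y ∈ D, ∀ s ∈ Set.Icc (0:ℝ) 1, o + s • (y - o) ∈ D) :
    ∃ h : E → G, TrivOn c D h := by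
  classical
  set γ : E → ℝ → E := fun y s => o + s • (y - o) with hγ
  have hcont : ∀ y, Continuous (γ y) := fun y => by fun_prop
  have hcont2 : Continuous (fun p : ℝ × E => γ p.2 p.1) := by
    simp only [hγ]; fun_prop
  have hex : ∀ y : E, ∃ h : ℝ → G, y ∈ D → h 0 = 1 ∧
      TrivOn (fun s s' => c (γ y s) (γ y s')) (Set.Icc 0 1) h := by
    intro y
    by_cases hy : y ∈ D
    · obtain ⟨h, hh⟩ := (H.comp (hcont y).continuousOn (fun s hs => hst y hy s hs)).interval
      exact ⟨h, fun _ => hh⟩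
    · exact ⟨fun _ => 1, fun h => absurd h hy⟩
  choose h hh using hex
  refine ⟨fun y => h y 1, ?_⟩
  intro y hy
  have hev : ∀ t ∈ Set.Icc (0:ℝ) 1, Tendsto (fun y' => γ y' t) (𝓝[D] y) (𝓝[D] (γ y t)) := by
    intro t ht
    have : Continuous (fun y' => γ y' t) := by simp only [hγ]; fun_prop
    exact this.continuousWithinAt.tendsto_nhdsWithin (fun y' hy' => hst y' hy' t ht)
  have key := eq_of_locConst (isPreconnected_Icc (a := (0:ℝ)) (b := 1))
    (fun t => ∀ᶠ y' in 𝓝[D] y, c (γ y t) (γ y' t) = (h y t)⁻¹ * h y' t) ?_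
    (x := 0) (y := 1) (by simp) (by simp)
  · have h1 : ∀ᶠ y' in 𝓝[D] y, c (γ y 1) (γ y' 1) = (h y 1)⁻¹ * h y' 1 := by
      rw [← key]
      filter_upwards [self_mem_nhdsWithin] with y' hy'
      have ho : o ∈ D := by simpa using hst y hy 0 (by simp)
      simp [hγ, (hh y hy).1, (hh y' hy').1, H.self ho]
    simpa [hγ] using h1
  · intro t0 ht0
    obtain ⟨U, hU, hyU, hk, hk2⟩ := H.local (hst y hy t0 ht0)
    set k := c (γ y t0) with hkdef
    have hnb : (fun p : ℝ × E => γ p.2 p.1) ⁻¹' U ∈ 𝓝 (t0, y) :=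
      hcont2.continuousAt.preimage_mem_nhds (hU.mem_nhds hyU)
    rw [nhds_prod_eq, mem_prod_iff] at hnb
    obtain ⟨J, hJ, N, hN, hJN⟩ := hnb
    obtain ⟨ε, hε, hball⟩ := Metric.mem_nhds_iff.1 hJ
    have hin : ∀ t ∈ Metric.ball t0 ε ∩ Set.Icc 0 1, ∀ y' ∈ N ∩ D, γ y' t ∈ U ∩ D := by
      intro t ht y' hy'
      exact ⟨hJN (Set.mk_mem_prod (hball ht.1) hy'.1), hst y' hy'.2 t ht.2⟩
    have hpre : IsPreconnected (Metric.ball t0 ε ∩ Set.Icc 0 1) :=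
      ((convex_ball t0 ε).inter (convex_Icc 0 1)).isPreconnected
    have hrel : ∀ y' ∈ N ∩ D, ∀ t ∈ Metric.ball t0 ε ∩ Set.Icc 0 1,
        ∀ t1 ∈ Metric.ball t0 ε ∩ Set.Icc 0 1,
        h y' t * (k (γ y' t))⁻¹ = h y' t1 * (k (γ y' t1))⁻¹ := by
      intro y' hy' t ht t1 ht1
      refine TrivOn.unique (c := fun s s' => c (γ y' s) (γ y' s')) (k := fun s => k (γ y' s)) hpre
        ((hh y' hy'.2).2.mono Set.inter_subset_right) ?_ ht ht1
      intro s hs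
      have : Tendsto (γ y') (𝓝[Metric.ball t0 ε ∩ Set.Icc 0 1] s) (𝓝[U ∩ D] (γ y' s)) :=
        (hcont y').continuousWithinAt.tendsto_nhdsWithin (fun s' hs' => hin s' hs' y' hy')
      exact this.eventually (hk _ (hin s hs y' hy'))
    have hyN : y ∈ N ∩ D := ⟨mem_of_mem_nhds hN, hy⟩
    have step : ∀ t ∈ Metric.ball t0 ε ∩ Set.Icc 0 1, ∀ t1 ∈ Metric.ball t0 ε ∩ Set.Icc 0 1,
        (∀ᶠ y' in 𝓝[D] y, c (γ y t1) (γ y' t1) = (h y t1)⁻¹ * h y' t1) →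
        (∀ᶠ y' in 𝓝[D] y, c (γ y t) (γ y' t) = (h y t)⁻¹ * h y' t) := by
      intro t ht t1 ht1 hp
      have f1 := (hev t ht.2).eventually (hk2 _ (hin t ht y hyN))
      have f2 := (hev t1 ht1.2).eventually (hk2 _ (hin t1 ht1 y hyN))
      filter_upwards [hp, f1, f2, nhdsWithin_le_nhds hN, self_mem_nhdsWithin] with y' g1 g2 g3 g4 g5
      have r1 := hrel y' ⟨g4, g5⟩ t ht t1 ht1
      have r2 := hrel y hyN t ht t1 ht1
      rw [g2]
      rw [g3] at g1
      have e1 : h y' t = h y' t1 * (k (γ y' t1))⁻¹ * k (γ y' t) := by rw [← r1]; group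
      have e2 : h y t = h y t1 * (k (γ y t1))⁻¹ * k (γ y t) := by rw [← r2]; group
      have e3 : h y' t1 = h y t1 * ((k (γ y t1))⁻¹ * k (γ y' t1)) := by
        rw [g1]; group
      rw [e1, e2, e3]; group
    have hmem : ∀ᶠ t in 𝓝[Set.Icc 0 1] t0, t ∈ Metric.ball t0 ε ∩ Set.Icc 0 1 :=
      inter_mem (nhdsWithin_le_nhds (Metric.ball_mem_nhds t0 hε)) self_mem_nhdsWithin
    filter_upwards [hmem] with t ht
    have ht00 : t0 ∈ Metric.ball t0 ε ∩ Set.Icc 0 1 := ⟨Metric.mem_ball_self hε, ht0⟩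
    exact propext ⟨step t0 ht00 t ht, step t ht t0 ht00⟩

end GenericTopology

end Part1

section Part2

open Filter Topology

section ConvexGeometry

set_option linter.unusedSectionVars false

open MeasureTheory

variable {E : Type*} [NormedAddCommGroup E] [NormedSpace ℝ E] [FiniteDimensional ℝ E]

theorem affineSpan_finset_ne_top (s : Finset E) (hs : s.card ≤ Module.finrank ℝ E)
    (hpos : 0 < Module.finrank ℝ E) :
    affineSpan ℝ (s : Set E) ≠ ⊤ := by
  intro h
  rcases s.eq_empty_or_nonempty with rfl | hne
  · simp at h
  have h1 : (affineSpan ℝ (s : Set E)).direction = ⊤ := by rw [h]; simp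
  rw [direction_affineSpan] at h1
  have h2 : Module.finrank ℝ (vectorSpan ℝ (s : Set E)) ≤ s.card - 1 := by
    classical
    have := finrank_vectorSpan_image_finset_le ℝ (id : E → E) s (n := s.card - 1)
      (by have := hne.card_pos; omega)
    rwa [Finset.image_id] at this
  rw [h1, finrank_top] at h2
  have := hne.card_pos
  omega

theorem exists_generic {ι : Type*} [Finite ι] {U : Set E} (hU : IsOpen U) (hne : U.Nonempty)
    (A : ι → AffineSubspace ℝ E) (hA : ∀ k, A k ≠ ⊤) : ∃ x ∈ U, ∀ k, x ∉ A k := by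
  borelize E
  let μ : Measure E := Measure.addHaar
  by_contra hcon
  push Not at hcon
  have h0 : μ (⋃ k, (A k : Set E)) = 0 := by
    rw [measure_iUnion_null_iff]
    intro k
    exact Measure.addHaar_affineSubspace μ (A k) (hA k)
  have h1 : U ⊆ ⋃ k, (A k : Set E) := by
    intro x hx
    obtain ⟨k, hk⟩ := hcon x hx
    exact Set.mem_iUnion.2 ⟨k, hk⟩
  have h2 := measure_mono_null h1 h0
  exact (hU.measure_pos μ hne).ne' h2

theorem preconnected_diff {ι : Type*} [Finite ι] {C R : Set E} (hC : Convex ℝ C)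
    (hint : (interior C).Nonempty) (T : ι → Finset E)
    (hT : ∀ k, (T k).card < Module.finrank ℝ E)
    (hR : R ⊆ ⋃ k, (affineSpan ℝ (T k : Set E) : Set E)) (hpos : 0 < Module.finrank ℝ E) :
    IsPreconnected (C \ R) := by
  classical
  have htop : ∀ k y, affineSpan ℝ (insert y (T k) : Set E) ≠ ⊤ := by
    intro k y
    have := affineSpan_finset_ne_top (insert y (T k))
      ((Finset.card_insert_le _ _).trans (hT k)) hpos
    simpa using this
  apply isPreconnected_of_forall_pair
  intro x hx y hy
  obtain ⟨z, hz, hzA⟩ := exists_generic isOpen_interior hint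
    (fun k : ι × Bool => affineSpan ℝ (insert (if k.2 then x else y) (T k.1) : Set E))
    (fun k => htop _ _)
  have hseg : ∀ w ∈ C \ R, (∀ k, z ∉ affineSpan ℝ (insert w (T k) : Set E)) →
      segment ℝ w z ⊆ C \ R := by
    intro w hw hwz u hu
    refine ⟨hC.segment_subset hw.1 (interior_subset hz) hu, fun huR => ?_⟩
    obtain ⟨k, hk⟩ := Set.mem_iUnion.1 (hR huR)
    rw [segment_eq_image_lineMap] at hu
    obtain ⟨s, hs, rfl⟩ := hu
    rcases eq_or_ne s 0 with rfl | hs0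
    · simp at huR; exact hw.2 huR
    apply hwz k
    have hw' : w ∈ affineSpan ℝ (insert w (T k) : Set E) :=
      subset_affineSpan ℝ _ (Set.mem_insert _ _)
    have hu' : AffineMap.lineMap w z s ∈ affineSpan ℝ (insert w (T k) : Set E) :=
      affineSpan_mono ℝ (Set.subset_insert _ _) hk
    have := AffineMap.lineMap_mem (s⁻¹) hw' hu'
    convert this using 1
    simp [AffineMap.lineMap_apply, smul_smul, inv_mul_cancel₀ hs0]
  refine ⟨segment ℝ x z ∪ segment ℝ y z, ?_, Or.inl (left_mem_segment ℝ x z),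
    Or.inr (left_mem_segment ℝ y z), ?_⟩
  · exact Set.union_subset (hseg x hx fun k => by simpa using hzA (k, true))
      (hseg y hy fun k => by simpa using hzA (k, false))
  · exact IsPreconnected.union z (right_mem_segment ℝ x z) (right_mem_segment ℝ y z)
      (convex_segment x z).isPreconnected (convex_segment y z).isPreconnected

theorem preconnected_diff_finite {C K : Set E} (hC : Convex ℝ C)
    (hint : (interior C).Nonempty) (hK : K.Finite) (h2 : 2 ≤ Module.finrank ℝ E) :
    IsPreconnected (C \ K) := by
  have := hK.to_subtype
  refine preconnected_diff hC hint (fun k : K => {k.1}) (fun k => by simp; omega) ?_ (by omega)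
  intro x hx
  exact Set.mem_iUnion.2 ⟨⟨x, hx⟩, by simp⟩

/-- The ray beyond `p` as seen from `o`. -/
def rayTail (o p : E) : Set E := (fun s : ℝ => o + s • (p - o)) '' Set.Ici 1

theorem isClosed_rayTail {o p : E} (h : p ≠ o) : IsClosed (rayTail o p) := by
  have h1 : Topology.IsClosedEmbedding (fun s : ℝ => s • (p - o)) :=
    isClosedEmbedding_smul_left (sub_ne_zero.2 h)
  have h2 : Topology.IsClosedEmbedding (fun s : ℝ => o + s • (p - o)) :=
    (Homeomorph.addLeft o).isClosedEmbedding.comp h1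
  exact h2.isClosedMap _ isClosed_Ici

theorem mem_rayTail_self (o p : E) : p ∈ rayTail o p := ⟨1, by simp, by simp⟩

theorem rayTail_subset (o p : E) : rayTail o p ⊆ (affineSpan ℝ ({o, p} : Set E) : Set E) := by
  rintro _ ⟨s, -, rfl⟩
  have := AffineMap.lineMap_mem_affineSpan_pair (k := ℝ) s o p
  simpa [AffineMap.lineMap_apply, add_comm] using this

/-- Every germ cocycle on the complement of a finite set in a convex body of dimension at
least three is trivial. -/
theorem CocOn.convex_diff_finite {G : Type*} [Group G] {c : E → E → G} {C K : Set E}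
    (hC : Convex ℝ C) (hint : (interior C).Nonempty) (hK : K.Finite)
    (h3 : 3 ≤ Module.finrank ℝ E) (H : CocOn c (C \ K)) : ∃ h : E → G, TrivOn c (C \ K) h := by
  classical
  haveI := hK.to_subtype
  obtain ⟨o₁, ho₁, hn₁⟩ := exists_generic isOpen_interior hint
    (fun k : K => affineSpan ℝ (({k.1} : Finset E) : Set E))
    (fun k => affineSpan_finset_ne_top _ (by simp; omega) (by omega))
  have hn₁' : ∀ p ∈ K, p ≠ o₁ := fun p hp h => hn₁ ⟨p, hp⟩ (by simp [h])
  obtain ⟨o₂, ho₂, hn₂⟩ := exists_generic isOpen_interior hint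
    (fun k : K × K => affineSpan ℝ (({o₁, k.1.1, k.2.1} : Finset E) : Set E))
    (fun k => affineSpan_finset_ne_top _ (Finset.card_le_three.trans h3) (by omega))
  have hn₂' : ∀ p ∈ K, p ≠ o₂ := fun p hp h => hn₂ (⟨p, hp⟩, ⟨p, hp⟩)
    (subset_affineSpan ℝ _ (by simp [h]))
  let W : E → Set E := fun o => ⋃ p ∈ K, rayTail o p
  have hWcl : ∀ o, (∀ p ∈ K, p ≠ o) → IsClosed (W o) := fun o ho =>
    hK.isClosed_biUnion fun p hp => isClosed_rayTail (ho p hp)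
  have hKW : ∀ o, K ⊆ W o := fun o p hp => Set.mem_biUnion hp (mem_rayTail_self o p)
  have hstar : ∀ o ∈ interior C, (∀ p ∈ K, p ≠ o) → ∃ h : E → G, TrivOn c (C \ W o) h := by
    intro o ho hne
    refine CocOn.star (o := o) (H.mono (Set.sdiff_subset_sdiff_right (hKW o))) ?_
    intro y hy s hs
    refine ⟨?_, ?_⟩
    · have := hC.segment_subset (interior_subset ho) hy.1
      apply this
      rw [segment_eq_image']
      exact ⟨s, hs, rfl⟩
    · intro hmem
      obtain ⟨p, hp, s', hs', heq⟩ := Set.mem_iUnion₂.1 hmem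
      have heq' : s' • (p - o) = s • (y - o) := by simpa using heq
      have hs'1 : (1:ℝ) ≤ s' := hs'
      have hs0 : s ≠ 0 := by
        rintro rfl
        rw [zero_smul, smul_eq_zero] at heq'
        rcases heq' with h | h
        · linarith
        · exact hne p hp (sub_eq_zero.1 h)
      apply hy.2
      refine Set.mem_biUnion hp ⟨s' / s, ?_, ?_⟩
      · have : 0 < s := lt_of_le_of_ne hs.1 (Ne.symm hs0)
        show 1 ≤ s' / s
        rw [le_div_iff₀ this]; linarith [hs.2]
      · show o + (s' / s) • (p - o) = y
        rw [div_eq_inv_mul, mul_smul, heq', smul_smul, inv_mul_cancel₀ hs0]; simp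
  obtain ⟨h₁, H₁⟩ := hstar o₁ ho₁ hn₁'
  obtain ⟨h₂, H₂⟩ := hstar o₂ ho₂ hn₂'
  have hcov : ∀ y ∈ C \ K, y ∉ W o₁ ∨ y ∉ W o₂ := by
    intro y hy
    by_contra hcon
    push Not at hcon
    obtain ⟨p, hp, hyp⟩ := Set.mem_iUnion₂.1 hcon.1
    obtain ⟨p', hp', s, hs, hys⟩ := Set.mem_iUnion₂.1 hcon.2
    have hys' : o₂ + s • (p' - o₂) = y := hys
    have hs1 : s ≠ 1 := by
      rintro rfl
      apply hy.2
      rw [← hys']; simpa using hp'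
    apply hn₂ (⟨p, hp⟩, ⟨p', hp'⟩)
    have m1 : y ∈ affineSpan ℝ (({o₁, p, p'} : Finset E) : Set E) :=
      affineSpan_mono ℝ (by intro z; simp; tauto) (rayTail_subset _ _ hyp)
    have m2 : p' ∈ affineSpan ℝ (({o₁, p, p'} : Finset E) : Set E) :=
      subset_affineSpan ℝ _ (by simp)
    have := AffineMap.lineMap_mem ((1 - s)⁻¹) m2 m1
    convert this using 1
    have h1s : (1 - s) ≠ 0 := sub_ne_zero.2 (Ne.symm hs1)
    have e : y - p' = (1 - s) • (o₂ - p') := by rw [← hys']; module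
    simp [AffineMap.lineMap_apply, e, smul_smul, inv_mul_cancel₀ h1s]
  have hpre : IsPreconnected (C \ (W o₁ ∪ W o₂)) := by
    refine preconnected_diff hC hint (ι := K × Bool)
      (fun k => {if k.2 then o₁ else o₂, k.1.1})
      (fun k => lt_of_le_of_lt Finset.card_le_two (by omega)) ?_ (by omega)
    rintro x (hx | hx)
    · obtain ⟨p, hp, hyp⟩ := Set.mem_iUnion₂.1 hx
      exact Set.mem_iUnion.2 ⟨(⟨p, hp⟩, true), by simpa using rayTail_subset _ _ hyp⟩
    · obtain ⟨p, hp, hyp⟩ := Set.mem_iUnion₂.1 hx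
      exact Set.mem_iUnion.2 ⟨(⟨p, hp⟩, false), by simpa using rayTail_subset _ _ hyp⟩
  have hκ : ∃ κ : G, ∀ y ∈ C \ (W o₁ ∪ W o₂), h₁ y = κ * h₂ y := by
    rcases (C \ (W o₁ ∪ W o₂)).eq_empty_or_nonempty with he | ⟨z, hz⟩
    · exact ⟨1, by rw [he]; simp⟩
    · refine ⟨h₁ z * (h₂ z)⁻¹, fun y hy => ?_⟩
      have := TrivOn.unique hpre
        (H₁.mono (Set.sdiff_subset_sdiff_right Set.subset_union_left))
        (H₂.mono (Set.sdiff_subset_sdiff_right Set.subset_union_right)) hy hz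
      rw [← this]; group
  obtain ⟨κ, hκ⟩ := hκ
  have hup : ∀ o, (∀ p ∈ K, p ≠ o) → ∀ h, TrivOn c (C \ W o) h → ∀ y ∈ C \ W o,
      ∀ᶠ y' in 𝓝[C \ K] y, y' ∉ W o ∧ c y y' = (h y)⁻¹ * h y' := by
    intro o ho h hh y hy
    have e1 := eventually_nhdsWithin_iff.1 (hh y hy)
    have e2 : ∀ᶠ y' in 𝓝 y, y' ∈ (W o)ᶜ := (hWcl o ho).isOpen_compl.mem_nhds hy.2
    filter_upwards [e1.filter_mono nhdsWithin_le_nhds, e2.filter_mono nhdsWithin_le_nhds,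
      self_mem_nhdsWithin] with z g1 g2 g3
    exact ⟨g2, g1 ⟨g3.1, g2⟩⟩
  refine ⟨fun y => if y ∈ W o₁ then κ * h₂ y else h₁ y, ?_⟩
  have hval : ∀ y ∈ C \ W o₂, (if y ∈ W o₁ then κ * h₂ y else h₁ y) = κ * h₂ y := by
    intro y hy
    split_ifs with h
    · rfl
    · exact hκ y ⟨hy.1, fun h' => h'.elim h hy.2⟩
  intro y hy
  rcases hcov y hy with h | h
  · filter_upwards [hup o₁ hn₁' h₁ H₁ y ⟨hy.1, h⟩] with z hz
    rw [if_neg h, if_neg hz.1, hz.2]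
  · filter_upwards [hup o₂ hn₂' h₂ H₂ y ⟨hy.1, h⟩, self_mem_nhdsWithin] with z hz hzC
    simp only [hval y ⟨hy.1, h⟩, hval z ⟨hzC.1, hz.1⟩]
    rw [hz.2]; group

end ConvexGeometry

end Part2

section Part3

open Filter Topology

section OctGeometry

/-- The sign attached to a boolean. -/
def sg (b : Bool) : ℝ := if b then 1 else -1

theorem sg_mul_self (b : Bool) : sg b * sg b = 1 := by cases b <;> simp [sg]

theorem abs_sg (b : Bool) : |sg b| = 1 := by cases b <;> simp [sg]

/-- The closed face of the solid octahedron. -/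
def FaceSet (F : OctFace) : Set (Fin 3 → ℝ) :=
  {x | (∀ i, 0 ≤ sg (F i) * x i) ∧ ∑ i, sg (F i) * x i = 1}

/-- The affine face identification, extended linearly to the whole space. -/
def fmap (g : Gluing) (F : OctFace) (x : Fin 3 → ℝ) : Fin 3 → ℝ :=
  fun j => sg (g.face F j) * (sg (F ((g.axisMap F)⁻¹ j)) * x ((g.axisMap F)⁻¹ j))

theorem gl_face_face (g : Gluing) (F : OctFace) : g.face (g.face F) = F := g.2.1 F

theorem gl_axis_face (g : Gluing) (F : OctFace) : g.axisMap (g.face F) = (g.axisMap F)⁻¹ :=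
  g.2.2.2.1 F

theorem fmap_mem {g : Gluing} {F : OctFace} {x : Fin 3 → ℝ} (hx : x ∈ FaceSet F) :
    fmap g F x ∈ FaceSet (g.face F) := by
  have e : ∀ j, sg (g.face F j) * fmap g F x j =
      sg (F ((g.axisMap F)⁻¹ j)) * x ((g.axisMap F)⁻¹ j) := by
    intro j
    rw [fmap, ← mul_assoc, sg_mul_self, one_mul]
  constructor
  · intro j; rw [e]; exact hx.1 _
  · simp only [e]
    rw [Equiv.sum_comp ((g.axisMap F)⁻¹ : Equiv.Perm (Fin 3)) (fun i => sg (F i) * x i)]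
    exact hx.2

theorem fmap_fmap (g : Gluing) (F : OctFace) (x : Fin 3 → ℝ) :
    fmap g (g.face F) (fmap g F x) = x := by
  funext j
  simp only [fmap, gl_face_face, gl_axis_face, inv_inv]
  have e : (g.axisMap F)⁻¹ ((g.axisMap F) j) = j := (g.axisMap F).symm_apply_apply j
  rw [e]
  rw [← mul_assoc (sg (g.face F _)), sg_mul_self, one_mul, ← mul_assoc, sg_mul_self, one_mul]

theorem continuous_fmap (g : Gluing) (F : OctFace) : Continuous (fmap g F) := by
  unfold fmap; fun_prop

theorem dist_fmap_le (g : Gluing) (F : OctFace) (x y : Fin 3 → ℝ) :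
    dist (fmap g F x) (fmap g F y) ≤ dist x y := by
  rw [dist_pi_le_iff dist_nonneg]
  intro j
  rw [Real.dist_eq, fmap, fmap, ← mul_sub, ← mul_sub, abs_mul, abs_mul, abs_sg, abs_sg, one_mul,
    one_mul, ← Real.dist_eq]
  exact dist_le_pi_dist x y _

theorem isClosed_faceSet (F : OctFace) : IsClosed (FaceSet F) := by
  unfold FaceSet
  simp only [Set.ofPred_and, Set.ofPred_forall]
  refine IsClosed.inter (isClosed_iInter fun i => isClosed_le (by fun_prop) (by fun_prop))
    (isClosed_eq (by fun_prop) (by fun_prop))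

theorem sum_vertexPt (F : OctFace) (w : Fin 3 → ℝ) :
    (∑ i, w i • vertexPt (i, F i)) = fun j => sg (F j) * w j := by
  funext j
  simp [Finset.sum_apply, vertexPt, sg, Finset.sum_ite_eq]

theorem sum_vertexPt' (g : Gluing) (F : OctFace) (w : Fin 3 → ℝ) :
    (∑ i, w i • vertexPt (g.axisMap F i, g.face F (g.axisMap F i))) =
      fun j => sg (g.face F j) * w ((g.axisMap F)⁻¹ j) := by
  rw [← sum_vertexPt (g.face F) (fun j => w ((g.axisMap F)⁻¹ j)),
    ← Equiv.sum_comp (g.axisMap F) (fun i => w ((g.axisMap F)⁻¹ i) • vertexPt (i, g.face F i))]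
  refine Finset.sum_congr rfl fun i _ => ?_
  have e : (g.axisMap F)⁻¹ ((g.axisMap F) i) = i := (g.axisMap F).symm_apply_apply i
  rw [e]

theorem faceSet_subset (F : OctFace) : FaceSet F ⊆ SolidOcta := by
  intro x hx
  have : x = ∑ i, (sg (F i) * x i) • vertexPt (i, F i) := by
    rw [sum_vertexPt]; funext j; rw [← mul_assoc, sg_mul_self, one_mul]
  rw [this]
  exact (convex_convexHull ℝ _).sum_mem (fun i _ => hx.1 i) hx.2
    (fun i _ => vertexPt_mem_solidOcta _)

/-- The generating relation on `ℝ³`. -/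
def gRel (g : Gluing) (x y : Fin 3 → ℝ) : Prop := ∃ F, x ∈ FaceSet F ∧ y = fmap g F x

/-- The identification relation on `ℝ³`. -/
def gEq (g : Gluing) (x y : Fin 3 → ℝ) : Prop := Relation.ReflTransGen (gRel g) x y

theorem gRel_symm {g : Gluing} {x y : Fin 3 → ℝ} (h : gRel g x y) : gRel g y x := by
  obtain ⟨F, hF, rfl⟩ := h
  exact ⟨g.face F, fmap_mem hF, (fmap_fmap g F x).symm⟩

theorem gEq_symm {g : Gluing} {x y : Fin 3 → ℝ} (h : gEq g x y) : gEq g y x := by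
  unfold gEq at *
  induction h with
  | refl => exact Relation.ReflTransGen.refl
  | tail _ h ih => exact Relation.ReflTransGen.head (gRel_symm h) ih

theorem glueRel_iff (g : Gluing) (x y : SolidOcta) : glueRel g x y ↔ gRel g x y := by
  constructor
  · rintro ⟨F, w, h0, h1, hx, hy⟩
    rw [sum_vertexPt] at hx
    rw [sum_vertexPt'] at hy
    refine ⟨F, ⟨fun i => ?_, ?_⟩, ?_⟩
    · rw [hx]; simp only []; rw [← mul_assoc, sg_mul_self, one_mul]; exact h0 i
    · rw [hx, ← h1]; refine Finset.sum_congr rfl fun i _ => ?_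
      simp only []; rw [← mul_assoc, sg_mul_self, one_mul]
    · rw [hy, hx]; funext j; simp only [fmap]; rw [← mul_assoc (sg (F _)), sg_mul_self, one_mul]
  · rintro ⟨F, hF, hy⟩
    refine ⟨F, fun i => sg (F i) * (x : Fin 3 → ℝ) i, hF.1, hF.2, ?_, ?_⟩
    · rw [sum_vertexPt]; funext j; rw [← mul_assoc, sg_mul_self, one_mul]
    · rw [sum_vertexPt', hy]; rfl

theorem gRel_mem {g : Gluing} {x y : Fin 3 → ℝ} (h : gRel g x y) : y ∈ SolidOcta := by
  obtain ⟨F, hF, rfl⟩ := h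
  exact faceSet_subset _ (fmap_mem hF)

theorem gEq_mem {g : Gluing} {x y : Fin 3 → ℝ} (h : gEq g x y) (hx : x ∈ SolidOcta) :
    y ∈ SolidOcta := by
  induction h with
  | refl => exact hx
  | tail _ h _ => exact gRel_mem h

theorem gEq_of_setoid {g : Gluing} {x y : SolidOcta} (h : Relation.EqvGen (glueRel g) x y) :
    gEq g x y := by
  induction h with
  | rel x y h => exact Relation.ReflTransGen.single ((glueRel_iff g x y).1 h)
  | refl x => exact Relation.ReflTransGen.refl
  | symm x y _ ih => exact gEq_symm ih
  | trans x y z _ _ h1 h2 => exact h1.trans h2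

theorem setoid_of_gEq {g : Gluing} {x y : Fin 3 → ℝ} (h : gEq g x y) (hx : x ∈ SolidOcta)
    (hy : y ∈ SolidOcta) : Relation.EqvGen (glueRel g) ⟨x, hx⟩ ⟨y, hy⟩ := by
  induction h with
  | refl => exact Relation.EqvGen.refl _
  | @tail b c h1 h2 ih =>
    have hb : b ∈ SolidOcta := gEq_mem h1 hx
    exact (ih hb).trans _ _ _ (Relation.EqvGen.rel _ _ ((glueRel_iff g ⟨b, hb⟩ ⟨c, hy⟩).2 h2))

open Classical in
/-- The quotient projection extended by a junk value. -/
noncomputable def Qm (g : Gluing) (y : Fin 3 → ℝ) : XSpace g :=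
  if h : y ∈ SolidOcta then Quotient.mk (glueSetoid g) ⟨y, h⟩
  else Quotient.mk (glueSetoid g) ⟨vertexPt (0, true), vertexPt_mem_solidOcta _⟩

theorem Qm_of_mem (g : Gluing) {y : Fin 3 → ℝ} (h : y ∈ SolidOcta) :
    Qm g y = Quotient.mk (glueSetoid g) ⟨y, h⟩ := by simp [Qm, h]

theorem Qm_eq_iff (g : Gluing) {x y : Fin 3 → ℝ} (hx : x ∈ SolidOcta) (hy : y ∈ SolidOcta) :
    Qm g x = Qm g y ↔ gEq g x y := by
  rw [Qm_of_mem g hx, Qm_of_mem g hy, Quotient.eq]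
  exact ⟨fun h => gEq_of_setoid h, fun h => setoid_of_gEq h hx hy⟩

theorem Qm_surj (g : Gluing) (a : XSpace g) : ∃ y ∈ SolidOcta, Qm g y = a := by
  induction a using Quotient.inductionOn with
  | h y => exact ⟨y.1, y.2, Qm_of_mem g y.2⟩

theorem continuousOn_Qm (g : Gluing) : ContinuousOn (Qm g) SolidOcta := by
  rw [continuousOn_iff_continuous_domRestrict]
  have : SolidOcta.domRestrict (Qm g) = Quotient.mk (glueSetoid g) := by
    funext y; exact Qm_of_mem g y.2
  rw [this]
  exact continuous_quotient_mk'

theorem gEq_finite (g : Gluing) (x : Fin 3 → ℝ) : {y | gEq g x y}.Finite := by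
  have hfin : (Set.range fun p : (Fin 3 → Bool) × Equiv.Perm (Fin 3) =>
      (fun i => sg (p.1 i) * x (p.2 i))).Finite := Set.finite_range _
  refine hfin.subset ?_
  intro y hy
  have hy' : gEq g x y := hy
  clear hy
  induction hy' with
  | refl => exact ⟨(fun _ => true, 1), by funext i; simp [sg]⟩
  | tail _ h ih =>
    obtain ⟨⟨ε, ρ⟩, rfl⟩ := ih
    obtain ⟨F, -, rfl⟩ := h
    refine ⟨(fun j => ! (Bool.xor (g.face F j) (Bool.xor (F ((g.axisMap F)⁻¹ j))
      (! ε ((g.axisMap F)⁻¹ j)))), ρ * (g.axisMap F)⁻¹), ?_⟩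
    funext j
    simp only [fmap, Equiv.Perm.mul_apply]
    rw [← mul_assoc, ← mul_assoc]
    congr 1
    generalize g.face F j = a
    generalize F _ = b
    generalize ε _ = d
    cases a <;> cases b <;> cases d <;> simp [sg]

/-- Admissible radii for the point `x`. -/
def Adm (g : Gluing) (x : Fin 3 → ℝ) (ε : ℝ) : Prop :=
  0 < ε ∧ (∀ w, gEq g x w → ∀ F, w ∉ FaceSet F → ∀ z, dist w z < ε → z ∉ FaceSet F) ∧
    ∀ w w', gEq g x w → gEq g x w' → w ≠ w' → 2 * ε ≤ dist w w'

theorem Adm.of_le {g : Gluing} {x : Fin 3 → ℝ} {ε ε' : ℝ} (h : Adm g x ε) (h0 : 0 < ε')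
    (hle : ε' ≤ ε) : Adm g x ε' :=
  ⟨h0, fun w hw F hF z hz => h.2.1 w hw F hF z (hz.trans_le hle),
    fun w w' h1 h2 h3 => le_trans (by linarith) (h.2.2 w w' h1 h2 h3)⟩

theorem Adm.of_gEq {g : Gluing} {x y : Fin 3 → ℝ} {ε : ℝ} (h : Adm g x ε) (hxy : gEq g x y) :
    Adm g y ε :=
  ⟨h.1, fun w hw => h.2.1 w (hxy.trans hw), fun w w' h1 h2 =>
    h.2.2 w w' (hxy.trans h1) (hxy.trans h2)⟩

theorem exists_pos_of_finite {ι : Type*} {s : Set ι} (hs : s.Finite) (P : ι → ℝ → Prop)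
    (hP : ∀ i ∈ s, ∃ ε > 0, ∀ ε', 0 < ε' → ε' ≤ ε → P i ε') :
    ∃ ε > 0, ∀ i ∈ s, P i ε := by
  have hev : ∀ᶠ ε in 𝓝[>] (0:ℝ), ∀ i ∈ s, P i ε := by
    rw [Set.Finite.eventually_all hs] 
    intro i hi
    obtain ⟨ε, hε, h⟩ := hP i hi
    filter_upwards [Ioc_mem_nhdsGT hε] with e he
    exact h e he.1 he.2
  obtain ⟨ε, h1, h2⟩ := (hev.and self_mem_nhdsWithin).exists
  exact ⟨ε, h2, h1⟩

theorem exists_adm (g : Gluing) (x : Fin 3 → ℝ) : ∃ ε, Adm g x ε := by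
  have hfin := gEq_finite g x
  obtain ⟨ε₁, h1, H1⟩ := exists_pos_of_finite (hfin.prod (Set.finite_univ (α := OctFace)))
    (fun p ε => p.1 ∉ FaceSet p.2 → ∀ z, dist p.1 z < ε → z ∉ FaceSet p.2) (by
      rintro ⟨w, F⟩ -
      by_cases hw : w ∈ FaceSet F
      · exact ⟨1, one_pos, fun _ _ _ h => absurd hw h⟩
      · obtain ⟨ε, hε, hb⟩ := Metric.isOpen_iff.1 (isClosed_faceSet F).isOpen_compl w hw
        refine ⟨ε, hε, fun ε' _ hle _ z hz => hb ?_⟩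
        rw [Metric.mem_ball, dist_comm]; exact hz.trans_le hle)
  obtain ⟨ε₂, h2, H2⟩ := exists_pos_of_finite (hfin.prod hfin)
    (fun p ε => p.1 ≠ p.2 → 2 * ε ≤ dist p.1 p.2) (by
      rintro ⟨w, w'⟩ -
      by_cases hw : w = w'
      · exact ⟨1, one_pos, fun _ _ _ h => absurd hw h⟩
      · refine ⟨dist w w' / 2, half_pos (dist_pos.2 hw), fun ε' _ hle _ => ?_⟩
        simp only []; linarith)
  refine ⟨min ε₁ ε₂, lt_min h1 h2, ?_, ?_⟩
  · intro w hw F hF z hz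
    exact H1 (w, F) ⟨hw, Set.mem_univ _⟩ hF z (hz.trans_le (min_le_left _ _))
  · intro w w' hw hw' hne
    have := H2 (w, w') ⟨hw, hw'⟩ hne
    simp only [] at this
    linarith [min_le_right ε₁ ε₂]

/-- Chain lemma. -/
theorem chain_lemma {g : Gluing} {x : Fin 3 → ℝ} {ε : ℝ} (h : Adm g x ε) {w z z' : Fin 3 → ℝ}
    (hw : gEq g x w) (hd : dist w z < ε) (hz : gEq g z z') :
    ∃ w', gEq g x w' ∧ dist w' z' ≤ dist w z ∧
      ∀ {G : Type} [Group G] (τ : (Fin 3 → ℝ) → G) (X : OctFace → G) (N : Set (Fin 3 → ℝ)),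
        (∀ F, ∀ y ∈ FaceSet F ∩ N, τ y = X F * τ (fmap g F y)) →
        (∀ F, ∀ y ∈ FaceSet F ∩ N, fmap g F y ∈ N) → w ∈ N → z ∈ N →
        z' ∈ N ∧ w' ∈ N ∧ (τ w)⁻¹ * τ z = (τ w')⁻¹ * τ z' := by
  induction hz with
  | refl => exact ⟨w, hw, le_rfl, fun τ X N _ _ h1 h2 => ⟨h2, h1, rfl⟩⟩
  | @tail b d hb hbd ih =>
    obtain ⟨w', h1, h2, h3⟩ := ih
    obtain ⟨F, hF, rfl⟩ := hbd
    have hwF : w' ∈ FaceSet F := by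
      by_contra hcon
      exact h.2.1 w' h1 F hcon b (h2.trans_lt hd) hF
    refine ⟨fmap g F w', h1.tail ⟨F, hwF, rfl⟩, (dist_fmap_le g F w' b).trans h2, ?_⟩
    intro G _ τ X N e1 e2 hwN hzN
    obtain ⟨i1, i2, i3⟩ := h3 τ X N e1 e2 hwN hzN
    refine ⟨e2 F b ⟨hF, i1⟩, e2 F w' ⟨hwF, i2⟩, ?_⟩
    rw [i3, e1 F b ⟨hF, i1⟩, e1 F w' ⟨hwF, i2⟩]; group

/-- Neighbourhoods in the quotient. -/
theorem eventually_near (g : Gluing) {x : Fin 3 → ℝ} (hx : x ∈ SolidOcta) {δ : ℝ} (hδ : 0 < δ) :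
    ∀ᶠ b in 𝓝 (Qm g x), ∀ y ∈ SolidOcta, Qm g y = b → ∃ w, gEq g x w ∧ dist w y < δ := by
  obtain ⟨ε, hε⟩ := exists_adm g x
  have hη : Adm g x (min ε δ) := hε.of_le (lt_min hε.1 hδ) (min_le_left _ _)
  set η := min ε δ with hηdef
  let V : Set (XSpace g) := {b | ∀ y ∈ SolidOcta, Qm g y = b → ∃ w, gEq g x w ∧ dist w y < η}
  have hVo : IsOpen V := by
    have hqm : Topology.IsQuotientMap (Quotient.mk (glueSetoid g)) := isQuotientMap_quotient_mk'
    rw [← hqm.isOpen_preimage]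
    have : (Quotient.mk (glueSetoid g)) ⁻¹' V =
        Subtype.val ⁻¹' (⋃ w ∈ {w | gEq g x w}, Metric.ball w η) := by
      ext y
      simp only [Set.mem_preimage, Set.mem_iUnion, Metric.mem_ball, Set.mem_ofPred_eq, V]
      constructor
      · intro h
        obtain ⟨w, hw, hd⟩ := h y.1 y.2 (Qm_of_mem g y.2)
        exact ⟨w, hw, by rwa [dist_comm]⟩
      · rintro ⟨w, hw, hd⟩ y' hy' he
        have e2 : gEq g y.1 y' := by
          rw [← Qm_eq_iff g y.2 hy', he]; exact Qm_of_mem g y.2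
        obtain ⟨w', h1, h2, -⟩ := chain_lemma hη hw (z := y.1) (by rwa [dist_comm]) e2
        exact ⟨w', h1, h2.trans_lt (by rwa [dist_comm])⟩
    rw [this]
    exact (isOpen_biUnion fun w _ => Metric.isOpen_ball).preimage continuous_subtype_val
  have hVx : Qm g x ∈ V := fun y hy he =>
    ⟨y, (Qm_eq_iff g hx hy).1 he.symm, by simpa using hη.1⟩
  filter_upwards [hVo.mem_nhds hVx] with b hb y hy he
  obtain ⟨w, hw, hd⟩ := hb y hy he
  exact ⟨w, hw, hd.trans_le (min_le_right _ _)⟩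

theorem eventually_lift (g : Gluing) {x : Fin 3 → ℝ} (hx : x ∈ SolidOcta)
    (P : (Fin 3 → ℝ) → (Fin 3 → ℝ) → Prop) (D : Set (Fin 3 → ℝ))
    (hP : ∀ w, gEq g x w → ∀ᶠ y in 𝓝[D] w, P w y) :
    ∀ᶠ b in 𝓝 (Qm g x), ∀ y ∈ SolidOcta ∩ D, Qm g y = b → ∃ w, gEq g x w ∧ P w y := by
  obtain ⟨δ, hδ, H⟩ := exists_pos_of_finite (gEq_finite g x)
    (fun w δ => ∀ y ∈ D, dist w y < δ → P w y) (by
      intro w hw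
      obtain ⟨δ, hδ, h⟩ := Metric.eventually_nhds_iff.1 (eventually_nhdsWithin_iff.1 (hP w hw))
      refine ⟨δ, hδ, fun ε' _ hle y hy hd => h ?_ hy⟩
      rw [dist_comm]; exact hd.trans_le hle)
  filter_upwards [eventually_near g hx hδ] with b hb y hy he
  obtain ⟨w, hw, hd⟩ := hb y hy.1 he
  exact ⟨w, hw, H w hw y hy.2 hd⟩

end OctGeometry

end Part3

section Part4

open Filter Topology

section Monodromy

theorem zero_mem_solidOcta : (0 : Fin 3 → ℝ) ∈ SolidOcta := by
  have h := (convex_convexHull ℝ (Set.range vertexPt)) (vertexPt_mem_solidOcta (0, true))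
    (vertexPt_mem_solidOcta (0, false)) (a := 1 / 2) (b := 1 / 2) (by norm_num) (by norm_num)
    (by norm_num)
  have e : (0 : Fin 3 → ℝ) = (1 / 2 : ℝ) • vertexPt (0, true) + (1 / 2 : ℝ) • vertexPt (0, false) := ?_
  · rw [e]; exact h
  funext j
  by_cases hj : j = 0 <;> simp [vertexPt, hj]

theorem interior_solidOcta_nonempty : (interior SolidOcta).Nonempty := by
  have hsub : {x : Fin 3 → ℝ | (∀ i, 0 < x i) ∧ ∑ i, x i < 1} ⊆ SolidOcta := by
    intro x hx
    have h := (convex_convexHull ℝ (Set.range vertexPt)).sum_mem (t := Finset.univ)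
      (w := ![x 0, x 1, x 2, 1 - ∑ i, x i])
      (z := ![vertexPt (0, true), vertexPt (1, true), vertexPt (2, true), 0])
      (by
        intro i _
        have h2 := hx.2
        fin_cases i
        · exact (hx.1 0).le
        · exact (hx.1 1).le
        · exact (hx.1 2).le
        · show 0 ≤ 1 - ∑ i, x i
          linarith)
      (by simp [Fin.sum_univ_succ]; ring)
      (by
        intro i _
        fin_cases i
        · exact vertexPt_mem_solidOcta _
        · exact vertexPt_mem_solidOcta _
        · exact vertexPt_mem_solidOcta _
        · exact zero_mem_solidOcta)
    have e : x = ∑ i, ![x 0, x 1, x 2, 1 - ∑ i, x i] i •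
        ![vertexPt (0, true), vertexPt (1, true), vertexPt (2, true), 0] i := ?_
    · rw [e]; exact h
    funext j
    fin_cases j <;> simp [Fin.sum_univ_succ, vertexPt]
  have ho : IsOpen {x : Fin 3 → ℝ | (∀ i, 0 < x i) ∧ ∑ i, x i < 1} := by
    simp only [Set.ofPred_and, Set.ofPred_forall]
    exact (isOpen_iInter_of_finite fun i => isOpen_lt (by fun_prop) (by fun_prop)).inter
      (isOpen_lt (by fun_prop) (by fun_prop))
  refine ⟨fun _ => 1 / 4, interior_mono hsub ?_⟩
  rw [ho.interior_eq]
  refine ⟨fun i => by norm_num, ?_⟩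
  simp [Fin.sum_univ_succ]; norm_num

theorem convex_solidOcta : Convex ℝ SolidOcta := convex_convexHull ℝ _

/-- Parallel sections of the flat bundle associated with a cocycle. -/
def HasSec {X G Z : Type} [TopologicalSpace X] [Group G] (c : X → X → G) (S : Set X)
    (ρ : G →* Equiv.Perm Z) : Prop :=
  ∃ s : X → Z, ∀ a ∈ Sᶜ, ∀ᶠ b in 𝓝[Sᶜ] a, s a = ρ (c a b) (s b)

/-- The parametrization of a face. -/
def facePar (F : OctFace) (p : ℝ × ℝ) : Fin 3 → ℝ :=
  ![sg (F 0) * p.1, sg (F 1) * p.2, sg (F 2) * (1 - p.1 - p.2)]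

theorem sg_ne_zero (b : Bool) : sg b ≠ 0 := by cases b <;> simp [sg]

theorem preconnected_face_diff (F : OctFace) {K : Set (Fin 3 → ℝ)} (hK : K.Finite) :
    IsPreconnected (FaceSet F \ K) := by
  let T : Set (ℝ × ℝ) := {p | 0 ≤ p.1 ∧ 0 ≤ p.2 ∧ p.1 + p.2 ≤ 1}
  have hTc : Convex ℝ T := by
    intro p hp q hq a b ha hb hab
    refine ⟨?_, ?_, ?_⟩
    · have := hp.1; have := hq.1; simp; positivity
    · have := hp.2.1; have := hq.2.1; simp; positivity
    · have h1 := hp.2.2; have h2 := hq.2.2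
      simp
      nlinarith
  have hTi : (interior T).Nonempty := by
    have ho : IsOpen {p : ℝ × ℝ | 0 < p.1 ∧ 0 < p.2 ∧ p.1 + p.2 < 1} := by
      simp only [Set.ofPred_and]
      exact (isOpen_lt (by fun_prop) (by fun_prop)).inter
        ((isOpen_lt (by fun_prop) (by fun_prop)).inter (isOpen_lt (by fun_prop) (by fun_prop)))
    have hsub : {p : ℝ × ℝ | 0 < p.1 ∧ 0 < p.2 ∧ p.1 + p.2 < 1} ⊆ T :=
      fun p hp => ⟨hp.1.le, hp.2.1.le, hp.2.2.le⟩
    refine ⟨(1 / 4, 1 / 4), interior_mono hsub ?_⟩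
    rw [ho.interior_eq]
    refine ⟨by norm_num, by norm_num, by norm_num⟩
  have hinj : Function.Injective (facePar F) := by
    intro p q h
    have h0 := congrFun h 0
    have h1 := congrFun h 1
    simp only [facePar, Matrix.cons_val_zero, Matrix.cons_val_one] at h0 h1
    exact Prod.ext (mul_left_cancel₀ (sg_ne_zero _) h0) (mul_left_cancel₀ (sg_ne_zero _) h1)
  have hpre := preconnected_diff_finite hTc hTi (hK.preimage (hinj.injOn (s := facePar F ⁻¹' K)))
    (by simp)
  have hcont : Continuous (facePar F) := by
    refine continuous_pi fun i => ?_
    fin_cases i <;> simp [facePar] <;> fun_prop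
  have himg : facePar F '' (T \ facePar F ⁻¹' K) = FaceSet F \ K := by
    ext x
    constructor
    · rintro ⟨p, ⟨hp, hpK⟩, rfl⟩
      refine ⟨⟨?_, ?_⟩, hpK⟩
      · intro i
        fin_cases i <;> simp only [facePar] <;> simp <;> rw [← mul_assoc, sg_mul_self, one_mul]
        · exact hp.1
        · exact hp.2.1
        · have := hp.2.2; linarith
      · simp only [Fin.sum_univ_three, facePar]
        simp only [Matrix.cons_val_zero, Matrix.cons_val_one, Matrix.cons_val, ← mul_assoc, sg_mul_self]
        ring
    · rintro ⟨hx, hxK⟩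
      have e : facePar F (sg (F 0) * x 0, sg (F 1) * x 1) = x := by
        have h2 := hx.2
        rw [Fin.sum_univ_three] at h2
        funext i
        fin_cases i
        · simp [facePar, ← mul_assoc, sg_mul_self]
        · simp [facePar, ← mul_assoc, sg_mul_self]
        · have : 1 - sg (F 0) * x 0 - sg (F 1) * x 1 = sg (F 2) * x 2 := by linarith
          simp [facePar, this]
          rw [← mul_assoc, sg_mul_self, one_mul]
      refine ⟨(sg (F 0) * x 0, sg (F 1) * x 1), ⟨⟨hx.1 0, hx.1 1, ?_⟩, ?_⟩, e⟩
      · have h2 := hx.2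
        have h3 := hx.1 2
        rw [Fin.sum_univ_three] at h2
        simp only []; linarith
      · show facePar F _ ∉ K
        rwa [e]
  rw [← himg]
  exact hpre.image _ hcont.continuousOn

/-- The point dividing an edge. -/
def edgePt (l : ℝ) (u v : OctVertex) : Fin 3 → ℝ := l • vertexPt u + (1 - l) • vertexPt v

theorem vertexPt_mem_faceSet (F : OctFace) (i : Fin 3) : vertexPt (i, F i) ∈ FaceSet F := by
  constructor
  · intro j
    by_cases h : j = i
    · subst h; cases F j <;> simp [vertexPt, sg]
    · simp [vertexPt, h]
  · rw [Finset.sum_eq_single i]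
    · cases F i <;> simp [vertexPt, sg]
    · intro j _ h; simp [vertexPt, h]
    · simp

theorem convex_faceSet (F : OctFace) : Convex ℝ (FaceSet F) := by
  intro p hp q hq a b ha hb hab
  refine ⟨fun i => ?_, ?_⟩
  · have h1 := hp.1 i
    have h2 := hq.1 i
    have : sg (F i) * (a • p + b • q) i = a * (sg (F i) * p i) + b * (sg (F i) * q i) := by
      simp; ring
    rw [this]; positivity
  · have : ∀ i, sg (F i) * (a • p + b • q) i = a * (sg (F i) * p i) + b * (sg (F i) * q i) := by
      intro i; simp; ring
    simp only [this]
    rw [Finset.sum_add_distrib, ← Finset.mul_sum, ← Finset.mul_sum, hp.2, hq.2]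
    linarith

theorem edgePt_mem {l : ℝ} (h0 : 0 ≤ l) (h1 : l ≤ 1) (F : OctFace) (i j : Fin 3) :
    edgePt l (i, F i) (j, F j) ∈ FaceSet F :=
  convex_faceSet F (vertexPt_mem_faceSet F i) (vertexPt_mem_faceSet F j) h0 (by linarith) (by ring)

theorem fmap_add_smul (g : Gluing) (F : OctFace) (a b : ℝ) (x y : Fin 3 → ℝ) :
    fmap g F (a • x + b • y) = a • fmap g F x + b • fmap g F y := by
  funext j; simp [fmap]; ring

theorem fmap_vertexPt (g : Gluing) (F : OctFace) (i : Fin 3) :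
    fmap g F (vertexPt (i, F i)) = vertexPt (g.axisMap F i, g.face F (g.axisMap F i)) := by
  funext j
  simp only [fmap, vertexPt]
  have e : (g.axisMap F)⁻¹ j = i ↔ j = g.axisMap F i := by
    rw [Equiv.Perm.inv_eq_iff_eq, eq_comm]
  by_cases h : j = g.axisMap F i
  · have h' := e.2 h
    rw [if_pos h', if_pos h, h', h]
    cases F i <;> cases g.face F (g.axisMap F i) <;> simp [sg]
  · rw [if_neg h, if_neg (fun h' => h (e.1 h'))]; simp

theorem fmap_edgePt (g : Gluing) (F : OctFace) (l : ℝ) (i j : Fin 3) :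
    fmap g F (edgePt l (i, F i) (j, F j)) =
      edgePt l (g.axisMap F i, g.face F (g.axisMap F i))
        (g.axisMap F j, g.face F (g.axisMap F j)) := by
  rw [edgePt, fmap_add_smul, fmap_vertexPt, fmap_vertexPt]; rfl

theorem edgePt_inj {u v : OctVertex} (h : u.1 ≠ v.1) : Function.Injective fun l => edgePt l u v := by
  intro l l' e
  have := congrFun e u.1
  have hv : vertexPt v u.1 = 0 := by simp [vertexPt, h]
  have hu : vertexPt u u.1 ≠ 0 := by simp only [vertexPt, if_true]; cases u.2 <;> simp
  simp only [edgePt, Pi.add_apply, Pi.smul_apply, hv, mul_zero, add_zero, smul_eq_mul] at this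
  exact mul_right_cancel₀ hu this

/-- Extraction of a holonomy representation from a cocycle. -/
theorem extraction (g : Gluing) {G : Type} [Group G] (S : Set (XSpace g)) (hS : S.Finite)
    (c : XSpace g → XSpace g → G) (hc : CocOn c Sᶜ) :
    ∃ (x : OctFace → G) (H : OctVertex → OctVertex → G),
      (∀ F, x (g.face F) = (x F)⁻¹) ∧
      (∀ F i j, i ≠ j → H (i, F i) (j, F j) =
        x F * H (g.axisMap F i, g.face F (g.axisMap F i))
          (g.axisMap F j, g.face F (g.axisMap F j))) ∧
      ∀ (Z : Type) (ρ : G →* Equiv.Perm Z) (z₀ : Z), (∀ F, ρ (x F) z₀ = z₀) → HasSec c S ρ := by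
  classical
  let K : Set (Fin 3 → ℝ) := SolidOcta ∩ Qm g ⁻¹' S
  have hK : K.Finite := by
    have : K ⊆ ⋃ a ∈ S, {y | y ∈ SolidOcta ∧ Qm g y = a} := by
      intro y hy
      exact Set.mem_biUnion hy.2 ⟨hy.1, rfl⟩
    refine (hS.biUnion fun a _ => ?_).subset this
    obtain ⟨y, hy, rfl⟩ := Qm_surj g a
    refine (gEq_finite g y).subset ?_
    intro z hz
    exact (Qm_eq_iff g hy hz.1).1 hz.2.symm
  have hmaps : Set.MapsTo (Qm g) (SolidOcta \ K) Sᶜ := fun y hy h => hy.2 ⟨hy.1, h⟩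
  have hcK := hc.comp ((continuousOn_Qm g).mono Set.sdiff_subset) hmaps
  obtain ⟨h, hh⟩ := hcK.convex_diff_finite convex_solidOcta interior_solidOcta_nonempty hK
    (by simp)
  have hQ : ∀ F, ∀ y ∈ FaceSet F, Qm g (fmap g F y) = Qm g y := fun F y hy =>
    ((Qm_eq_iff g (faceSet_subset _ hy) (faceSet_subset _ (fmap_mem hy))).2
      (Relation.ReflTransGen.single ⟨F, hy, rfl⟩)).symm
  have hfK : ∀ F, ∀ y ∈ FaceSet F \ K, fmap g F y ∈ SolidOcta \ K := by
    intro F y hy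
    refine ⟨faceSet_subset _ (fmap_mem hy.1), fun hk => hy.2 ⟨faceSet_subset _ hy.1, ?_⟩⟩
    have := hk.2
    rwa [Set.mem_preimage, hQ F y hy.1] at this
  have hxex : ∀ F, ∃ x : G, ∀ y ∈ FaceSet F \ K, h y = x * h (fmap g F y) := by
    intro F
    rcases (FaceSet F \ K).eq_empty_or_nonempty with he | ⟨y₀, hy₀⟩
    · exact ⟨1, by rw [he]; simp⟩
    refine ⟨h y₀ * (h (fmap g F y₀))⁻¹, fun y hy => ?_⟩
    have key := eq_of_locConst (preconnected_face_diff F hK) (fun y => h y * (h (fmap g F y))⁻¹) ?_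
      hy hy₀
    · rw [← key]; group
    · intro z hz
      have e1 := (hh z ⟨faceSet_subset _ hz.1, hz.2⟩).filter_mono
        (nhdsWithin_mono z (Set.sdiff_subset_sdiff_left (faceSet_subset F)))
      have tend : Tendsto (fmap g F) (𝓝[FaceSet F \ K] z) (𝓝[SolidOcta \ K] (fmap g F z)) :=
        (continuous_fmap g F).continuousWithinAt.tendsto_nhdsWithin (hfK F)
      have e2 := tend.eventually (hh _ (hfK F z hz))
      filter_upwards [e1, e2, self_mem_nhdsWithin] with w g1 g2 g3
      rw [hQ F z hz.1, hQ F w g3.1] at g2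
      rw [g1] at g2
      have : h w = h z * ((h (fmap g F z))⁻¹ * h (fmap g F w)) := by rw [← g2]; group
      rw [this]; group
  choose x hx using hxex
  obtain ⟨l, ⟨hl0, hl1⟩, hl⟩ : ∃ l : ℝ, (0 < l ∧ l < 1) ∧
      ∀ u v : OctVertex, u.1 ≠ v.1 → edgePt l u v ∉ K := by
    have hfin : (⋃ p : {p : OctVertex × OctVertex // p.1.1 ≠ p.2.1},
        (fun l => edgePt l p.1.1 p.1.2) ⁻¹' K).Finite :=
      Set.finite_iUnion fun p => hK.preimage (edgePt_inj p.2).injOn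
    obtain ⟨l, hl, hn⟩ := (Set.Ioo_infinite (zero_lt_one' ℝ)).exists_notMem_finite hfin
    refine ⟨l, hl, fun u v huv hk => hn (Set.mem_iUnion.2 ⟨⟨(u, v), huv⟩, hk⟩)⟩
  have hedge : ∀ F i j, i ≠ j → edgePt l (i, F i) (j, F j) ∈ FaceSet F \ K := fun F i j hij =>
    ⟨edgePt_mem hl0.le hl1.le F i j, hl _ _ hij⟩
  refine ⟨x, fun u v => h (edgePt l u v), ?_, ?_, ?_⟩
  · intro F
    have m := hedge F 0 1 (by decide)
    have a1 := hx F _ m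
    have a2 := hx (g.face F) _ ⟨fmap_mem m.1, (hfK F _ m).2⟩
    rw [fmap_fmap] at a2
    rw [a2, ← mul_assoc] at a1
    have : 1 = x F * x (g.face F) := by
      have := mul_right_cancel (b := h (edgePt l (0, F 0) (1, F 1))) (a := 1)
        (c := x F * x (g.face F)) (by rw [one_mul]; exact a1)
      exact this
    exact eq_inv_of_mul_eq_one_right this.symm
  · intro F i j hij
    have := hx F _ (hedge F i j hij)
    rwa [fmap_edgePt] at this
  · intro Z ρ z₀ hz
    have hinv : ∀ y y', gEq g y y' → y ∈ SolidOcta \ K →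
        y' ∈ SolidOcta \ K ∧ ρ (h y)⁻¹ z₀ = ρ (h y')⁻¹ z₀ := by
      intro y y' hyy hy
      induction hyy with
      | refl => exact ⟨hy, rfl⟩
      | @tail b d _ hbd ih =>
        obtain ⟨F, hF, rfl⟩ := hbd
        have hb : b ∈ FaceSet F \ K := ⟨hF, ih.1.2⟩
        refine ⟨hfK F _ hb, ?_⟩
        rw [ih.2, hx F b hb, mul_inv_rev, map_mul, Equiv.Perm.mul_apply, map_inv ρ (x F)]
        congr 1
        rw [Equiv.Perm.inv_eq_iff_eq, hz F]
    choose lift hlift hlift2 using Qm_surj g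
    refine ⟨fun a => ρ (h (lift a))⁻¹ z₀, ?_⟩
    intro a ha
    have haK : lift a ∈ SolidOcta \ K := ⟨hlift a, fun hk => ha (by rw [← hlift2 a]; exact hk.2)⟩
    have ev := eventually_lift g (hlift a) (fun w y => c (Qm g w) (Qm g y) = (h w)⁻¹ * h y)
      (SolidOcta \ K) (fun w hw => hh w (hinv _ _ hw haK).1)
    rw [hlift2 a] at ev
    filter_upwards [ev.filter_mono nhdsWithin_le_nhds, self_mem_nhdsWithin] with b hb hbS
    have hbK : lift b ∈ SolidOcta \ K :=
      ⟨hlift b, fun hk => hbS (by rw [← hlift2 b]; exact hk.2)⟩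
    obtain ⟨w, hw, hcw⟩ := hb (lift b) ⟨hlift b, hbK⟩ (hlift2 b)
    have hwC := (hinv _ _ hw haK)
    have e : Qm g w = a := by
      rw [← hlift2 a]; exact ((Qm_eq_iff g (hlift a) hwC.1.1).2 hw).symm
    rw [e, hlift2 b] at hcw
    rw [hwC.2, hcw, ← Equiv.Perm.mul_apply, ← map_mul]
    congr 2
    group

end Monodromy

end Part4

section Part5

open Filter Topology

section Existence

/-- Non-vertices. -/
def NonVtx : Set (Fin 3 → ℝ) := (Set.range vertexPt)ᶜ

theorem vertexPt_face_sign {v : OctVertex} {F : OctFace} (h : vertexPt v ∈ FaceSet F) :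
    v = (v.1, F v.1) := by
  have h1 := h.1 v.1
  simp only [vertexPt, if_true] at h1
  refine Prod.ext rfl ?_
  simp only []
  revert h1
  cases v.2 <;> cases F v.1 <;> simp [sg] <;> norm_num

theorem fmap_nonVtx {g : Gluing} {F : OctFace} {y : Fin 3 → ℝ} (hy : y ∈ FaceSet F ∩ NonVtx) :
    fmap g F y ∈ NonVtx := by
  rintro ⟨v, hv⟩
  have h1 : vertexPt v ∈ FaceSet (g.face F) := by rw [hv]; exact fmap_mem hy.1
  apply hy.2
  rw [← fmap_fmap g F y, ← hv, vertexPt_face_sign h1, fmap_vertexPt]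
  exact ⟨_, rfl⟩

variable {G : Type} [Group G]

open Classical in
/-- The stratified function on the solid octahedron used to build a cocycle. -/
noncomputable def tauFun (T : OctFace → G) (H : OctVertex → OctVertex → G) (y : Fin 3 → ℝ) : G :=
  if ∀ F, y ∉ FaceSet F then 1
  else if y 0 = 0 then H (1, decide (0 < y 1)) (2, decide (0 < y 2))
  else if y 1 = 0 then H (0, decide (0 < y 0)) (2, decide (0 < y 2))
  else if y 2 = 0 then H (0, decide (0 < y 0)) (1, decide (0 < y 1))
  else T fun i => decide (0 < y i)

theorem face_sign_eq {y : Fin 3 → ℝ} {F : OctFace} (hy : y ∈ FaceSet F) {i : Fin 3}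
    (hi : y i ≠ 0) : decide (0 < y i) = F i := by
  have h := hy.1 i
  cases hF : F i
  · simp [sg, hF] at h ⊢; exact h
  · simp [sg, hF] at h ⊢; exact lt_of_le_of_ne h (Ne.symm hi)

theorem tauFun_face (T : OctFace → G) (H : OctVertex → OctVertex → G) {y : Fin 3 → ℝ} {F : OctFace}
    (hy : y ∈ FaceSet F) (hne : ∀ i, y i ≠ 0) : tauFun T H y = T F := by
  unfold tauFun
  rw [if_neg (fun h => h F hy), if_neg (hne 0), if_neg (hne 1), if_neg (hne 2)]
  congr 1
  funext i
  exact face_sign_eq hy (hne i)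

theorem tauFun_edge (T : OctFace → G) (H : OctVertex → OctVertex → G)
    (hH : ∀ u v, H u v = H v u) {y : Fin 3 → ℝ} {F : OctFace}
    (hy : y ∈ FaceSet F) {i j k : Fin 3} (hij : i ≠ j) (hik : k ≠ i) (hjk : k ≠ j) (hk : y k = 0)
    (hi : y i ≠ 0) (hj : y j ≠ 0) : tauFun T H y = H (i, F i) (j, F j) := by
  unfold tauFun
  rw [if_neg (fun h => h F hy)]
  rw [← face_sign_eq hy hi, ← face_sign_eq hy hj]
  have hH' := hH (i, decide (0 < y i)) (j, decide (0 < y j))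
  clear hH
  fin_cases i <;> fin_cases j <;> fin_cases k <;> simp_all

theorem exists_two_nonzero {y : Fin 3 → ℝ} {F : OctFace} (hy : y ∈ FaceSet F ∩ NonVtx)
    {k : Fin 3} (hk : y k = 0) : ∀ i, i ≠ k → y i ≠ 0 := by
  intro i hik hi
  apply hy.2
  obtain ⟨j, hji, hjk⟩ : ∃ j : Fin 3, j ≠ i ∧ j ≠ k := by
    clear hi hk hy; revert hik; revert i k; decide
  have h3 : ∀ m : Fin 3, m ≠ j → y m = 0 := by
    intro m hm
    have : m = i ∨ m = k := by clear hi hk hy; revert hik hji hjk hm; revert m j i k; decide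
    rcases this with rfl | rfl <;> assumption
  have hs := hy.1.2
  rw [Finset.sum_eq_single j (fun m _ hm => by rw [h3 m hm, mul_zero]) (by simp)] at hs
  refine ⟨(j, F j), ?_⟩
  funext m
  by_cases hm : m = j
  · subst hm
    have : y m = sg (F m) := by
      have e := congrArg (fun t => sg (F m) * t) hs
      simp only [← mul_assoc, sg_mul_self, one_mul, mul_one] at e
      exact e
    rw [this]; simp [vertexPt, sg]
  · rw [h3 m hm]; simp [vertexPt, hm]

theorem tauFun_equivariant (g : Gluing) (T : OctFace → G) (H : OctVertex → OctVertex → G)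
    (hH : ∀ u v, H u v = H v u) (X : OctFace → G) (hT : ∀ F, T F = X F * T (g.face F))
    (hE : ∀ F i j, i ≠ j → H (i, F i) (j, F j) =
        X F * H (g.axisMap F i, g.face F (g.axisMap F i))
          (g.axisMap F j, g.face F (g.axisMap F j))) :
    ∀ F, ∀ y ∈ FaceSet F ∩ NonVtx, tauFun T H y = X F * tauFun T H (fmap g F y) := by
  intro F y hy
  have hval : ∀ i, fmap g F y (g.axisMap F i) = 0 ↔ y i = 0 := by
    intro i
    have e : (g.axisMap F)⁻¹ ((g.axisMap F) i) = i := (g.axisMap F).symm_apply_apply i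
    simp only [fmap, e, mul_eq_zero, sg_ne_zero, false_or]
  by_cases hall : ∀ i, y i ≠ 0
  · rw [tauFun_face T H hy.1 hall, tauFun_face T H (fmap_mem hy.1) ?_]
    · exact hT F
    · intro j
      obtain ⟨i, rfl⟩ := (g.axisMap F).surjective j
      rw [Ne, hval]; exact hall i
  · push Not at hall
    obtain ⟨k, hk⟩ := hall
    obtain ⟨i, j, hij, hki, hkj⟩ : ∃ i j : Fin 3, i ≠ j ∧ k ≠ i ∧ k ≠ j := by
      clear hk; revert k; decide
    have hn := exists_two_nonzero hy hk
    rw [tauFun_edge T H hH hy.1 hij hki hkj hk (hn i hki.symm) (hn j hkj.symm),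
      tauFun_edge T H hH (fmap_mem hy.1) (i := g.axisMap F i) (j := g.axisMap F j)
        (k := g.axisMap F k) ?_ ?_ ?_ ?_ ?_ ?_]
    · exact hE F i j hij
    · exact fun h => hij ((g.axisMap F).injective h)
    · exact fun h => hki ((g.axisMap F).injective h)
    · exact fun h => hkj ((g.axisMap F).injective h)
    · exact (hval k).2 hk
    · rw [Ne, hval]; exact hn i hki.symm
    · rw [Ne, hval]; exact hn j hkj.symm

/-- Existence of cocycles with prescribed holonomy. -/
theorem existence (g : Gluing) (T : OctFace → G) (H : OctVertex → OctVertex → G)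
    (hH : ∀ u v, H u v = H v u) (X : OctFace → G) (hT : ∀ F, T F = X F * T (g.face F))
    (hE : ∀ F i j, i ≠ j → H (i, F i) (j, F j) =
        X F * H (g.axisMap F i, g.face F (g.axisMap F i))
          (g.axisMap F j, g.face F (g.axisMap F j))) :
    ∃ S : Set (XSpace g), S.Finite ∧ ∃ c : XSpace g → XSpace g → G, CocOn c Sᶜ ∧
      ∀ (Z : Type) (ρ : G →* Equiv.Perm Z), HasSec c S ρ → ∃ z₀, ∀ F, ρ (X F) z₀ = z₀ := by
  classical
  set τ := tauFun T H with hτ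
  have hτe := tauFun_equivariant g T H hH X hT hE
  have hNe : ∀ F, ∀ y ∈ FaceSet F ∩ NonVtx, fmap g F y ∈ NonVtx := fun F y hy => fmap_nonVtx hy
  have hNinv : ∀ x y, gEq g x y → x ∈ NonVtx → y ∈ NonVtx := by
    intro x y h hx
    induction h with
    | refl => exact hx
    | tail _ h ih =>
      obtain ⟨F, hF, rfl⟩ := h
      exact fmap_nonVtx ⟨hF, ih⟩
  let S : Set (XSpace g) := Qm g '' Set.range vertexPt
  have hSN : ∀ y ∈ SolidOcta, Qm g y ∈ Sᶜ ↔ y ∈ NonVtx := by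
    intro y hy
    constructor
    · intro h hv
      exact h ⟨y, hv, rfl⟩
    · rintro h ⟨z, hz, he⟩
      have hzC : z ∈ SolidOcta := by
        obtain ⟨v, rfl⟩ := hz; exact vertexPt_mem_solidOcta v
      exact hNinv _ _ ((Qm_eq_iff g hy hzC).1 he.symm) h hz
  choose lift hlift hlift2 using Qm_surj g
  choose ε hε using fun a : XSpace g => exists_adm g (lift a)
  have hεy : ∀ y ∈ SolidOcta, Adm g y (ε (Qm g y)) := fun y hy =>
    (hε (Qm g y)).of_gEq ((Qm_eq_iff g (hlift _) hy).1 (hlift2 _))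
  let R : XSpace g → XSpace g → G → Prop := fun a b γ => ∃ y ∈ SolidOcta, ∃ y' ∈ SolidOcta,
    Qm g y = a ∧ Qm g y' = b ∧ dist y y' < ε a ∧ γ = (τ y)⁻¹ * τ y'
  let c : XSpace g → XSpace g → G := fun a b => if h : ∃ γ, R a b γ then h.choose else 1
  have hcval : ∀ y ∈ SolidOcta, ∀ y' ∈ SolidOcta, y ∈ NonVtx → y' ∈ NonVtx →
      dist y y' < ε (Qm g y) → c (Qm g y) (Qm g y') = (τ y)⁻¹ * τ y' := by
    intro y hy y' hy' hyN hyN' hd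
    have hex : ∃ γ, R (Qm g y) (Qm g y') γ := ⟨_, y, hy, y', hy', rfl, rfl, hd, rfl⟩
    have hcc : c (Qm g y) (Qm g y') = hex.choose := dif_pos hex
    obtain ⟨z, hz, z', hz', e1, e2, hd2, e3⟩ := hex.choose_spec
    rw [hcc, e3]
    have hA := hεy y hy
    have hyz : gEq g y z := (Qm_eq_iff g hy hz).1 e1.symm
    have hyz' : gEq g y' z' := (Qm_eq_iff g hy' hz').1 e2.symm
    obtain ⟨w, hw, hwd, hwτ⟩ := chain_lemma hA Relation.ReflTransGen.refl hd hyz'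
    have hwz : w = z := by
      by_contra hne
      have h1 := hA.2.2 w z hw hyz hne
      have h2 := dist_triangle w z' z
      rw [dist_comm z' z] at h2
      linarith
    obtain ⟨-, -, h3⟩ := hwτ τ X NonVtx hτe hNe hyN hyN'
    rw [h3, hwz]
  refine ⟨S, (Set.finite_range vertexPt).image _, c, ?_, ?_⟩
  · intro a ha
    have haN : lift a ∈ NonVtx := (hSN _ (hlift a)).1 (by rw [hlift2]; exact ha)
    have ev := eventually_near g (hlift a) (hε a).1
    rw [hlift2] at ev
    filter_upwards [ev.filter_mono nhdsWithin_le_nhds, self_mem_nhdsWithin] with b hb hbS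
    have hbN : lift b ∈ NonVtx := (hSN _ (hlift b)).1 (by rw [hlift2]; exact hbS)
    have ev2 := eventually_lift g (hlift b) (fun w' y => dist w' y < ε b ∧
      ∃ w, gEq g (lift a) w ∧ dist w w' < ε a ∧ dist w y < ε a) Set.univ (by
        intro w' hw'
        have hw'C := gEq_mem hw' (hlift b)
        obtain ⟨w, hw, hd⟩ := hb w' hw'C (by
          rw [← hlift2 b]; exact ((Qm_eq_iff g (hlift b) hw'C).2 hw').symm)
        have t1 : ∀ᶠ y in 𝓝 w', dist w' y < ε b :=
          (continuous_const.dist continuous_id).continuousAt.eventually_lt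
            continuousAt_const (by simpa using (hε b).1)
        have t2 : ∀ᶠ y in 𝓝 w', dist w y < ε a :=
          (continuous_const.dist continuous_id).continuousAt.eventually_lt
            continuousAt_const (by simpa using hd)
        rw [nhdsWithin_univ]
        filter_upwards [t1, t2] with y h1 h2
        exact ⟨h1, w, hw, hd, h2⟩)
    rw [hlift2] at ev2
    filter_upwards [ev2.filter_mono nhdsWithin_le_nhds, self_mem_nhdsWithin] with d hd hdS
    obtain ⟨w', hw', h1, w, hw, h2, h3⟩ := hd (lift d) ⟨hlift d, Set.mem_univ _⟩ (hlift2 d)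
    have hdN : lift d ∈ NonVtx := (hSN _ (hlift d)).1 (by rw [hlift2]; exact hdS)
    have hwC := gEq_mem hw (hlift a)
    have hwC' := gEq_mem hw' (hlift b)
    have ea : Qm g w = a := by rw [← hlift2 a]; exact ((Qm_eq_iff g (hlift a) hwC).2 hw).symm
    have eb : Qm g w' = b := by rw [← hlift2 b]; exact ((Qm_eq_iff g (hlift b) hwC').2 hw').symm
    have hwN := hNinv _ _ hw haN
    have hwN' := hNinv _ _ hw' hbN
    have v1 := hcval w hwC w' hwC' hwN hwN' (by rw [ea]; exact h2)
    have v2 := hcval w' hwC' (lift d) (hlift d) hwN' hdN (by rw [eb]; exact h1)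
    have v3 := hcval w hwC (lift d) (hlift d) hwN hdN (by rw [ea]; exact h3)
    rw [ea, eb] at v1
    rw [eb, hlift2] at v2
    rw [ea, hlift2] at v3
    rw [v1, v2, v3]; group
  · rintro Z ρ ⟨s, hs⟩
    have hpre : IsPreconnected (SolidOcta \ Set.range vertexPt) :=
      preconnected_diff_finite convex_solidOcta interior_solidOcta_nonempty
        (Set.finite_range _) (by simp)
    have hmaps : Set.MapsTo (Qm g) (SolidOcta \ Set.range vertexPt) Sᶜ :=
      fun y hy => (hSN y hy.1).2 hy.2
    have hconst : ∀ x ∈ SolidOcta \ Set.range vertexPt, ∀ y ∈ SolidOcta \ Set.range vertexPt,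
        ρ (τ x) (s (Qm g x)) = ρ (τ y) (s (Qm g y)) := by
      intro x hx y hy
      refine eq_of_locConst hpre (fun x => ρ (τ x) (s (Qm g x))) ?_ hx hy
      intro z hz
      have tend : Tendsto (Qm g) (𝓝[SolidOcta \ Set.range vertexPt] z) (𝓝[Sᶜ] (Qm g z)) :=
        (((continuousOn_Qm g).mono Set.sdiff_subset) z hz).tendsto_nhdsWithin hmaps
      have e1 := tend.eventually (hs _ (hmaps hz))
      have e2 : ∀ᶠ w in 𝓝 z, dist z w < ε (Qm g z) :=
          (continuous_const.dist continuous_id).continuousAt.eventually_lt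
            continuousAt_const (by simpa using (hε _).1)
      filter_upwards [e1, e2.filter_mono nhdsWithin_le_nhds, self_mem_nhdsWithin] with w g1 g2 g3
      rw [g1, hcval z hz.1 w g3.1 hz.2 g3.2 g2, ← Equiv.Perm.mul_apply, ← map_mul]
      congr 2
      group
    have hctr : ∀ F : OctFace, (fun i => sg (F i) / 3) ∈ FaceSet F ∩ NonVtx := by
      intro F
      refine ⟨⟨fun i => ?_, ?_⟩, ?_⟩
      · rw [← mul_div_assoc, sg_mul_self]; norm_num
      · simp only [← mul_div_assoc, sg_mul_self]; simp
      · rintro ⟨v, hv⟩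
        have := congrFun hv v.1
        simp only [vertexPt, if_true] at this
        revert this
        cases v.2 <;> cases F v.1 <;> simp [sg] <;> norm_num
    have hmem : ∀ F y, y ∈ FaceSet F ∩ NonVtx → y ∈ SolidOcta \ Set.range vertexPt :=
      fun F y hy => ⟨faceSet_subset F hy.1, hy.2⟩
    let y₀ : Fin 3 → ℝ := fun i => sg ((fun _ => true : OctFace) i) / 3
    refine ⟨ρ (τ y₀) (s (Qm g y₀)), fun F => ?_⟩
    have m := hctr F
    set y : Fin 3 → ℝ := fun i => sg (F i) / 3
    have m' : fmap g F y ∈ FaceSet (g.face F) ∩ NonVtx := ⟨fmap_mem m.1, fmap_nonVtx m⟩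
    have h1 := hconst _ (hmem _ _ (hctr fun _ => true)) _ (hmem _ _ m)
    have h2 := hconst _ (hmem _ _ (hctr fun _ => true)) _ (hmem _ _ m')
    have hQ : Qm g (fmap g F y) = Qm g y :=
      ((Qm_eq_iff g (faceSet_subset _ m.1) (faceSet_subset _ m'.1)).2
      (Relation.ReflTransGen.single ⟨F, m.1, rfl⟩)).symm
    calc ρ (X F) (ρ (τ y₀) (s (Qm g y₀)))
        = ρ (X F) (ρ (τ (fmap g F y)) (s (Qm g (fmap g F y)))) := by rw [← h2]
      _ = ρ (τ y) (s (Qm g y)) := by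
        rw [hQ, ← Equiv.Perm.mul_apply, ← map_mul, ← hτe F y m]
      _ = _ := h1.symm

end Existence

end Part5

section Part6

open Filter Topology

section FiniteAlgebra

/-- Powers of the primitive root `2` modulo `5`. -/
def pw : ZMod 4 → ZMod 5 := fun e => (![1, 2, 4, 3] : Fin 4 → ZMod 5) e

theorem pw_add : ∀ a b, pw (a + b) = pw a * pw b := by decide

theorem pw_zero : pw 0 = 1 := by decide

theorem pw_neg_mul : ∀ a, pw (-a) * pw a = 1 := by decide

/-- A finite solvable group: the semidirect product of `𝔽₅²` and `𝔽₅ˣ`. -/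
@[ext]
structure Gam where
  e : ZMod 4
  u : ZMod 5
  v : ZMod 5
deriving DecidableEq

instance : Mul Gam := ⟨fun a b => ⟨a.e + b.e, a.u + pw a.e * b.u, a.v + pw a.e * b.v⟩⟩
instance : One Gam := ⟨⟨0, 0, 0⟩⟩
instance : Inv Gam := ⟨fun a => ⟨-a.e, -(pw (-a.e) * a.u), -(pw (-a.e) * a.v)⟩⟩

theorem Gam.mul_e (a b : Gam) : (a * b).e = a.e + b.e := rfl
theorem Gam.mul_u (a b : Gam) : (a * b).u = a.u + pw a.e * b.u := rfl
theorem Gam.mul_v (a b : Gam) : (a * b).v = a.v + pw a.e * b.v := rfl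
theorem Gam.one_e : (1 : Gam).e = 0 := rfl
theorem Gam.one_u : (1 : Gam).u = 0 := rfl
theorem Gam.one_v : (1 : Gam).v = 0 := rfl
theorem Gam.inv_e (a : Gam) : (a⁻¹).e = -a.e := rfl
theorem Gam.inv_u (a : Gam) : (a⁻¹).u = -(pw (-a.e) * a.u) := rfl
theorem Gam.inv_v (a : Gam) : (a⁻¹).v = -(pw (-a.e) * a.v) := rfl

instance : Group Gam := Group.ofLeftAxioms
  (by
    intro a b c
    ext
    · simp only [Gam.mul_e]; ring
    · simp only [Gam.mul_e, Gam.mul_u, pw_add]; ring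
    · simp only [Gam.mul_e, Gam.mul_v, pw_add]; ring)
  (by
    intro a
    ext <;> simp [Gam.mul_e, Gam.mul_u, Gam.mul_v, Gam.one_e, Gam.one_u, Gam.one_v, pw_zero])
  (by
    intro a
    ext <;> simp [Gam.mul_e, Gam.mul_u, Gam.mul_v, Gam.one_e, Gam.one_u, Gam.one_v, Gam.inv_e,
      Gam.inv_u, Gam.inv_v])

/-- A permutation representation from an explicit action. -/
def permRep {G Z : Type} [Group G] (f : G → Z → Z) (h1 : ∀ z, f 1 z = z)
    (hm : ∀ a b z, f (a * b) z = f a (f b z)) : G →* Equiv.Perm Z where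
  toFun a := ⟨f a, f a⁻¹, fun z => by rw [← hm, inv_mul_cancel, h1],
    fun z => by rw [← hm, mul_inv_cancel, h1]⟩
  map_one' := by ext z; exact h1 z
  map_mul' a b := by ext z; exact hm a b z

/-- Affine action. -/
def affRep (α β : ZMod 5) : Gam →* Equiv.Perm (ZMod 5) :=
  permRep (fun a z => pw a.e * z + α * a.u + β * a.v)
    (by intro z; simp [Gam.one_e, Gam.one_u, Gam.one_v, pw_zero])
    (by intro a b z; simp only [Gam.mul_e, Gam.mul_u, Gam.mul_v, pw_add]; ring)

/-- Translation action of the squared characters. -/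
def trRep (m n : ZMod 4) : Gam × Gam →* Equiv.Perm (ZMod 4) :=
  permRep (fun a z => m * a.1.e + n * a.2.e + z)
    (by intro z; simp [Gam.one_e])
    (by intro a b z; simp only [Prod.fst_mul, Prod.snd_mul, Gam.mul_e]; ring)

/-- The topological invariant distinguishing the two quotient spaces. -/
def PInv (X : Type) [TopologicalSpace X] : Prop :=
  ∃ S : Set X, S.Finite ∧ ∃ c : X → X → Gam × Gam, CocOn c Sᶜ ∧
    (∀ α β : ZMod 5, ¬ (α = 0 ∧ β = 0) →
      ¬ HasSec c S ((affRep α β).comp (MonoidHom.fst Gam Gam)) ∧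
      ¬ HasSec c S ((affRep α β).comp (MonoidHom.snd Gam Gam))) ∧
    ¬ HasSec c S (trRep 2 0) ∧ ¬ HasSec c S (trRep 0 2) ∧ ¬ HasSec c S (trRep 2 2)

theorem PInv.homeo {X Y : Type} [TopologicalSpace X] [TopologicalSpace Y] (f : X ≃ₜ Y)
    (h : PInv X) : PInv Y := by
  obtain ⟨S, hS, c, hc, h1, h2, h3, h4⟩ := h
  have hpre : ∀ y, y ∈ (f '' S)ᶜ ↔ f.symm y ∈ Sᶜ := by
    intro y
    rw [Set.mem_compl_iff, Set.mem_compl_iff, not_iff_not]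
    constructor
    · rintro ⟨x, hx, rfl⟩; simpa using hx
    · intro h; exact ⟨_, h, by simp⟩
  have hsec : ∀ {Z : Type} (ρ : Gam × Gam →* Equiv.Perm Z),
      HasSec (fun a b => c (f.symm a) (f.symm b)) (f '' S) ρ → HasSec c S ρ := by
    rintro Z ρ ⟨s, hs⟩
    refine ⟨fun x => s (f x), fun a ha => ?_⟩
    have tend : Tendsto f (𝓝[Sᶜ] a) (𝓝[(f '' S)ᶜ] (f a)) :=
      f.continuous.continuousWithinAt.tendsto_nhdsWithin
        (fun x hx => (hpre _).2 (by simpa using hx))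
    have := tend.eventually (hs (f a) ((hpre _).2 (by simpa using ha)))
    simpa using this
  refine ⟨f '' S, hS.image f, fun a b => c (f.symm a) (f.symm b),
    hc.comp f.symm.continuous.continuousOn (fun y hy => (hpre y).1 hy), ?_, ?_, ?_, ?_⟩
  · intro α β hab
    exact ⟨fun h => (h1 α β hab).1 (hsec _ h), fun h => (h1 α β hab).2 (hsec _ h)⟩
  · exact fun h => h2 (hsec _ h)
  · exact fun h => h3 (hsec _ h)
  · exact fun h => h4 (hsec _ h)

/-- The common face pairing of the two patterns. -/
def sigmaFun (F : OctFace) : OctFace :=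
  if F 0 then ![F 0, ! F 1, ! F 2] else ![F 0, F 1, ! F 2]

def sigmaPerm : Equiv.Perm OctFace := ⟨sigmaFun, sigmaFun, by decide, by decide⟩

def rotP : Equiv.Perm (Fin 3) := ⟨![1, 2, 0], ![2, 0, 1], by decide, by decide⟩
def rotM : Equiv.Perm (Fin 3) := ⟨![2, 0, 1], ![1, 2, 0], by decide, by decide⟩
def swp : Equiv.Perm (Fin 3) := ⟨![0, 2, 1], ![0, 2, 1], by decide, by decide⟩

def gA : Gluing := ⟨(sigmaPerm, fun F => if F 0 then swp else if F 2 then rotM else rotP), by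
  unfold IsGluing; decide +kernel⟩

def gB : Gluing := ⟨(sigmaPerm, fun F => if F 0 then swp else if Bool.xor (F 1) (F 2) then rotM
  else rotP), by unfold IsGluing; decide +kernel⟩

/-- Holonomy of the first pattern on representatives of the face pairs. -/
def xA (F : OctFace) : Gam × Gam :=
  if F 0 then
    (if F 2 then (if F 1 then (⟨1, 0, 0⟩, ⟨0, 1, 0⟩)⁻¹ else (⟨2, 0, 0⟩, ⟨0, 4, 1⟩))
    else (if F 1 then (⟨2, 0, 0⟩, ⟨0, 4, 1⟩)⁻¹ else (⟨1, 0, 0⟩, ⟨0, 1, 0⟩)))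
  else
    (if F 2 then (if F 1 then (⟨3, 1, 0⟩, ⟨1, 0, 1⟩)⁻¹ else (⟨0, 0, 1⟩, ⟨1, 0, 0⟩)⁻¹)
    else (if F 1 then (⟨3, 1, 0⟩, ⟨1, 0, 1⟩) else (⟨0, 0, 1⟩, ⟨1, 0, 0⟩)))

def tA (F : OctFace) : Gam × Gam :=
  if F 0 then (if F 1 then 1 else xA F) else (if F 2 then 1 else xA F)

def edgeTbl : OctVertex → OctVertex → Gam × Gam
  | (0, false), (1, false) => (⟨0, 0, 0⟩, ⟨0, 0, 0⟩)
  | (0, false), (1, true) => (⟨1, 3, 2⟩, ⟨0, 0, 2⟩)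
  | (0, false), (2, false) => (⟨0, 0, 1⟩, ⟨1, 0, 0⟩)
  | (0, false), (2, true) => (⟨3, 3, 2⟩, ⟨2, 3, 4⟩)
  | (0, true), (1, false) => (⟨0, 0, 0⟩, ⟨0, 0, 0⟩)
  | (0, true), (1, true) => (⟨1, 0, 0⟩, ⟨0, 0, 4⟩)
  | (0, true), (2, false) => (⟨2, 0, 0⟩, ⟨0, 1, 4⟩)
  | (0, true), (2, true) => (⟨3, 0, 0⟩, ⟨0, 4, 0⟩)
  | (1, false), (2, false) => (⟨3, 3, 3⟩, ⟨3, 1, 3⟩)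
  | (1, false), (2, true) => (⟨0, 0, 4⟩, ⟨3, 0, 0⟩)
  | (1, true), (2, false) => (⟨2, 0, 1⟩, ⟨3, 1, 4⟩)
  | (1, true), (2, true) => (⟨2, 4, 4⟩, ⟨3, 0, 3⟩)
  | _, _ => 1

def hA (u v : OctVertex) : Gam × Gam := if u.1 < v.1 then edgeTbl u v else edgeTbl v u

theorem pinv_gA : PInv (XSpace gA) := by
  obtain ⟨S, hS, c, hc, h⟩ := existence gA tA hA (by decide +kernel) xA (by decide +kernel)
    (by decide +kernel)
  refine ⟨S, hS, c, hc, ?_, ?_, ?_, ?_⟩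
  · intro α β hab
    constructor
    · intro hs
      obtain ⟨z, hz⟩ := h _ _ hs
      have : ∀ F, pw (xA F).1.e * z + α * (xA F).1.u + β * (xA F).1.v = z := hz
      have k : ∀ α β z : ZMod 5, ¬ (α = 0 ∧ β = 0) → ¬ ∀ F, pw (xA F).1.e * z + α * (xA F).1.u +
        β * (xA F).1.v = z := by decide +kernel
      exact k α β z hab this
    · intro hs
      obtain ⟨z, hz⟩ := h _ _ hs
      have : ∀ F, pw (xA F).2.e * z + α * (xA F).2.u + β * (xA F).2.v = z := hz
      have k : ∀ α β z : ZMod 5, ¬ (α = 0 ∧ β = 0) → ¬ ∀ F, pw (xA F).2.e * z + α * (xA F).2.u +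
        β * (xA F).2.v = z := by decide +kernel
      exact k α β z hab this
  · intro hs
    obtain ⟨z, hz⟩ := h _ _ hs
    have : ∀ F, 2 * (xA F).1.e + 0 * (xA F).2.e + z = z := hz
    have k : ∀ z : ZMod 4, ¬ ∀ F, 2 * (xA F).1.e + 0 * (xA F).2.e + z = z := by decide +kernel
    exact k z this
  · intro hs
    obtain ⟨z, hz⟩ := h _ _ hs
    have : ∀ F, 0 * (xA F).1.e + 2 * (xA F).2.e + z = z := hz
    have k : ∀ z : ZMod 4, ¬ ∀ F, 0 * (xA F).1.e + 2 * (xA F).2.e + z = z := by decide +kernel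
    exact k z this
  · intro hs
    obtain ⟨z, hz⟩ := h _ _ hs
    have : ∀ F, 2 * (xA F).1.e + 2 * (xA F).2.e + z = z := hz
    have k : ∀ z : ZMod 4, ¬ ∀ F, 2 * (xA F).1.e + 2 * (xA F).2.e + z = z := by decide +kernel
    exact k z this

instance : Fact (Nat.Prime 5) := ⟨by norm_num⟩

/-- Two vectors in the kernel of a nonzero functional on a plane are proportional. -/
theorem proportional (d1 d2 a b a' b' : ZMod 5) (hd : d1 ≠ 0 ∨ d2 ≠ 0)
    (h : d1 * a + d2 * b = 0) (h' : d1 * a' + d2 * b' = 0) :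
    ∃ α β : ZMod 5, ¬ (α = 0 ∧ β = 0) ∧ α * a + β * a' = 0 ∧ α * b + β * b' = 0 := by
  have hdet : a * b' - a' * b = 0 := by
    rcases hd with hd | hd
    · apply mul_left_cancel₀ hd
      linear_combination b' * h - b * h'
    · apply mul_left_cancel₀ hd
      linear_combination a * h' - a' * h
  by_cases ha : a = 0
  · by_cases hb : b = 0
    · exact ⟨1, 0, by simp, by simp [ha], by simp [hb]⟩
    · exact ⟨-b', b, fun h => hb h.2, by linear_combination -hdet, by ring⟩
  · exact ⟨-a', a, fun h => ha h.2, by ring, by linear_combination hdet⟩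

theorem coef_ne : ∀ e1 e2 e3 e4 : ZMod 4, e1 + e2 + e3 + e4 = 0 → ¬ (e3 = 0 ∧ e4 = 0) →
    (1 - pw e4 * pw e2 * pw e2 + pw e4 * pw e2 * pw e3) ≠ 0 ∨
    (pw e1 * pw e4 + pw e1 * pw e4 * pw e2 - pw e4 * pw e3 * pw e2) ≠ 0 := by decide +kernel

theorem pw_eq_one : ∀ e, pw e = 1 → e = 0 := by decide

/-- One coordinate of the relations. -/
def RelU (t1 t2 t3 t4 u1 u2 u3 u4 : ZMod 5) : Prop :=
  (1 - t4 * t2 * t2 + t4 * t2 * t3) * u1 + (t1 * t4 + t1 * t4 * t2 - t4 * t3 * t2) * u2 +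
    t4 * t2 * t2 * u3 + t1 * u4 = 0 ∧ u3 + t3 * u4 = u4 + t4 * u3

theorem shift_exists (t1 t2 t3 t4 u1 u2 u3 u4 : ZMod 5) (ht : t1 * t2 * t3 * t4 = 1)
    (hne : t3 ≠ 1 ∨ t4 ≠ 1) (h : RelU t1 t2 t3 t4 u1 u2 u3 u4) :
    ∃ z, u3 = (1 - t3) * z ∧ u4 = (1 - t4) * z ∧
      (1 - t4 * t2 * t2 + t4 * t2 * t3) * (u1 - (1 - t1) * z) +
        (t1 * t4 + t1 * t4 * t2 - t4 * t3 * t2) * (u2 - (1 - t2) * z) = 0 := by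
  obtain ⟨h1, h2⟩ := h
  have : ∃ z, u3 = (1 - t3) * z ∧ u4 = (1 - t4) * z := by
    rcases hne with hne | hne
    · have hn : 1 - t3 ≠ 0 := sub_ne_zero.2 (Ne.symm hne)
      refine ⟨u3 / (1 - t3), by field_simp, ?_⟩
      field_simp
      linear_combination -h2
    · have hn : 1 - t4 ≠ 0 := sub_ne_zero.2 (Ne.symm hne)
      refine ⟨u4 / (1 - t4), ?_, by field_simp⟩
      field_simp
      linear_combination h2
  obtain ⟨z, rfl, rfl⟩ := this
  refine ⟨z, rfl, rfl, ?_⟩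
  linear_combination h1 + z * ht

theorem fixed_or_trivial (x1 x2 x3 x4 : Gam)
    (h1 : x1 * x4 * x2 * x2 * x1⁻¹ * x3 * x2⁻¹ * x1 = 1) (h2 : x3 * x4 = x4 * x3) :
    (∃ α β z : ZMod 5, ¬ (α = 0 ∧ β = 0) ∧ ∀ x ∈ [x1, x2, x3, x4], affRep α β x z = z) ∨
      (x3.e = 0 ∧ x4.e = 0 ∧ x2.e = - x1.e) := by
  have he : x1.e + x2.e + x3.e + x4.e = 0 := by
    have := congrArg Gam.e h1
    simp only [Gam.mul_e, Gam.inv_e, Gam.one_e] at this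
    rw [← this]; ring
  by_cases hex : x3.e = 0 ∧ x4.e = 0
  · right
    refine ⟨hex.1, hex.2, ?_⟩
    rw [hex.1, hex.2] at he
    linear_combination he
  left
  have p1 := pw_neg_mul x1.e
  have p2 := pw_neg_mul x2.e
  have ht : pw x1.e * pw x2.e * pw x3.e * pw x4.e = 1 := by
    rw [← pw_add, ← pw_add, ← pw_add, he, pw_zero]
  have hne : pw x3.e ≠ 1 ∨ pw x4.e ≠ 1 := by
    by_contra hcon
    push Not at hcon
    exact hex ⟨pw_eq_one _ hcon.1, pw_eq_one _ hcon.2⟩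
  have ru : RelU (pw x1.e) (pw x2.e) (pw x3.e) (pw x4.e) x1.u x2.u x3.u x4.u := by
    constructor
    · have := congrArg Gam.u h1
      simp only [Gam.mul_e, Gam.inv_e, Gam.one_u, Gam.mul_u, Gam.inv_u, pw_add] at this
      generalize pw (-x1.e) = s1 at *
      generalize pw (-x2.e) = s2 at *
      generalize pw x1.e = t1 at *
      generalize pw x2.e = t2 at *
      generalize pw x3.e = t3 at *
      generalize pw x4.e = t4 at *
      linear_combination this + (t4 * t2 * t2 * (x1.u - x3.u) - t4 * t2 * t3 * (x1.u - x2.u) * (s2 * t2)) * p1 -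
        t4 * t2 * t3 * (x1.u - x2.u) * p2
    · have := congrArg Gam.u h2
      simpa only [Gam.mul_u] using this
  have rv : RelU (pw x1.e) (pw x2.e) (pw x3.e) (pw x4.e) x1.v x2.v x3.v x4.v := by
    constructor
    · have := congrArg Gam.v h1
      simp only [Gam.mul_e, Gam.inv_e, Gam.one_v, Gam.mul_v, Gam.inv_v, pw_add] at this
      generalize pw (-x1.e) = s1 at *
      generalize pw (-x2.e) = s2 at *
      generalize pw x1.e = t1 at *
      generalize pw x2.e = t2 at *
      generalize pw x3.e = t3 at *
      generalize pw x4.e = t4 at *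
      linear_combination this + (t4 * t2 * t2 * (x1.v - x3.v) - t4 * t2 * t3 * (x1.v - x2.v) * (s2 * t2)) * p1 -
        t4 * t2 * t3 * (x1.v - x2.v) * p2
    · have := congrArg Gam.v h2
      simpa only [Gam.mul_v] using this
  obtain ⟨z, a3, a4, a⟩ := shift_exists _ _ _ _ _ _ _ _ ht hne ru
  obtain ⟨w, b3, b4, b⟩ := shift_exists _ _ _ _ _ _ _ _ ht hne rv
  obtain ⟨α, β, hab, e1, e2⟩ := proportional _ _ _ _ _ _ (coef_ne _ _ _ _ he hex) a b
  refine ⟨α, β, α * z + β * w, hab, ?_⟩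
  intro x hx
  show pw x.e * (α * z + β * w) + α * x.u + β * x.v = α * z + β * w
  simp only [List.mem_cons, List.not_mem_nil, or_false] at hx
  rcases hx with rfl | rfl | rfl | rfl
  · linear_combination e1
  · linear_combination e2
  · rw [a3, b3]; ring
  · rw [a4, b4]; ring

theorem not_pinv_gB : ¬ PInv (XSpace gB) := by
  rintro ⟨S, hS, c, hc, h1, h20, h02, h22⟩
  obtain ⟨x, H, hinv, hE, hsec⟩ := extraction gB S hS c hc
  have i1 : x ![false, false, true] = (x ![false, false, false])⁻¹ := by
    rw [← hinv]; congr 1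
  have i2 : x ![false, true, true] = (x ![false, true, false])⁻¹ := by
    rw [← hinv]; congr 1
  have i3 : x ![true, true, true] = (x ![true, false, false])⁻¹ := by
    rw [← hinv]; congr 1
  have i4 : x ![true, true, false] = (x ![true, false, true])⁻¹ := by
    rw [← hinv]; congr 1
  have k1 : H (0, false) (1, false) = x ![false, false, false] * H (1, false) (2, true) :=
    hE ![false, false, false] 0 1 (by decide)
  have k2 : H (1, false) (2, true) = x ![true, false, true] * H (2, false) (1, true) :=
    hE ![true, false, true] 1 2 (by decide)
  have k3 : H (2, false) (1, true) = x ![false, true, false] * H (1, true) (0, false) :=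
    hE ![false, true, false] 2 1 (by decide)
  have k4 : H (1, true) (0, false) = x ![false, true, false] * H (0, false) (2, true) :=
    hE ![false, true, false] 1 0 (by decide)
  have k5 : H (0, false) (2, true) = x ![false, false, true] * H (2, false) (1, false) :=
    hE ![false, false, true] 0 2 (by decide)
  have k6 : H (2, false) (1, false) = x ![true, false, false] * H (1, true) (2, true) :=
    hE ![true, false, false] 2 1 (by decide)
  have k7 : H (1, true) (2, true) = x ![false, true, true] * H (2, false) (0, false) :=
    hE ![false, true, true] 1 2 (by decide)
  have k8 : H (2, false) (0, false) = x ![false, false, false] * H (0, false) (1, false) :=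
    hE ![false, false, false] 2 0 (by decide)
  have k9 : H (0, true) (1, false) = x ![true, false, false] * H (0, true) (2, true) :=
    hE ![true, false, false] 0 1 (by decide)
  have k10 : H (0, true) (2, true) = x ![true, false, true] * H (0, true) (1, true) :=
    hE ![true, false, true] 0 2 (by decide)
  have k11 : H (0, true) (1, true) = x ![true, true, true] * H (0, true) (2, false) :=
    hE ![true, true, true] 0 1 (by decide)
  have k12 : H (0, true) (2, false) = x ![true, true, false] * H (0, true) (1, false) :=
    hE ![true, true, false] 0 2 (by decide)
  rw [i1] at k5
  rw [i2] at k7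
  rw [i3] at k11
  rw [i4] at k12
  generalize hx1 : x ![false, false, false] = x1 at *
  generalize hx2 : x ![false, true, false] = x2 at *
  generalize hx3 : x ![true, false, false] = x3 at *
  generalize hx4 : x ![true, false, true] = x4 at *
  have w1 : x1 * x4 * x2 * x2 * x1⁻¹ * x3 * x2⁻¹ * x1 = 1 := by
    rw [k2, k3, k4, k5, k6, k7, k8] at k1
    refine mul_right_cancel (b := H (0, false) (1, false)) ?_
    rw [one_mul]
    conv_rhs => rw [k1]
    group
  have w2 : x3 * x4 = x4 * x3 := by
    rw [k10, k11, k12] at k9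
    have : x3 * x4 * x3⁻¹ * x4⁻¹ = 1 := by
      refine mul_right_cancel (b := H (0, true) (1, false)) ?_
      rw [one_mul]
      conv_rhs => rw [k9]
      group
    have h3 := mul_inv_eq_one.1 this
    exact mul_inv_eq_iff_eq_mul.1 h3
  have hall : ∀ F, x F ∈ [x1, x2, x3, x4, x1⁻¹, x2⁻¹, x3⁻¹, x4⁻¹] := by
    have hF : ∀ F : OctFace, F = ![false, false, false] ∨ F = ![false, true, false] ∨
        F = ![true, false, false] ∨ F = ![true, false, true] ∨ F = ![false, false, true] ∨
        F = ![false, true, true] ∨ F = ![true, true, true] ∨ F = ![true, true, false] := by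
      decide +kernel
    intro F
    rcases hF F with h | h | h | h | h | h | h | h <;>
      simp [h, hx1, hx2, hx3, hx4, i1, i2, i3, i4]
  have hfix : ∀ {Z : Type} (ρ : Gam × Gam →* Equiv.Perm Z) (z : Z),
      (∀ y ∈ [x1, x2, x3, x4], ρ y z = z) → HasSec c S ρ := by
    intro Z ρ z hz
    refine hsec Z ρ z fun F => ?_
    have hi : ∀ y, ρ y z = z → ρ y⁻¹ z = z := by
      intro y hy
      rw [map_inv, Equiv.Perm.inv_eq_iff_eq]
      exact hy.symm
    have := hall F
    simp only [List.mem_cons, List.not_mem_nil, or_false] at this hz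
    rcases this with h | h | h | h | h | h | h | h <;> rw [h]
    · exact hz _ (by simp)
    · exact hz _ (by simp)
    · exact hz _ (by simp)
    · exact hz _ (by simp)
    · exact hi _ (hz _ (by simp))
    · exact hi _ (hz _ (by simp))
    · exact hi _ (hz _ (by simp))
    · exact hi _ (hz _ (by simp))
  have f1 : x3.1.e = 0 ∧ x4.1.e = 0 ∧ x2.1.e = - x1.1.e := by
    rcases fixed_or_trivial x1.1 x2.1 x3.1 x4.1 (congrArg Prod.fst w1) (congrArg Prod.fst w2)
      with ⟨α, β, z, hab, hz⟩ | h
    · refine absurd (hfix _ z ?_) (h1 α β hab).1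
      intro y hy
      apply hz
      simp only [List.mem_cons, List.not_mem_nil, or_false] at hy ⊢
      rcases hy with rfl | rfl | rfl | rfl <;> simp
    · exact h
  have f2 : x3.2.e = 0 ∧ x4.2.e = 0 ∧ x2.2.e = - x1.2.e := by
    rcases fixed_or_trivial x1.2 x2.2 x3.2 x4.2 (congrArg Prod.snd w1) (congrArg Prod.snd w2)
      with ⟨α, β, z, hab, hz⟩ | h
    · refine absurd (hfix _ z ?_) (h1 α β hab).2
      intro y hy
      apply hz
      simp only [List.mem_cons, List.not_mem_nil, or_false] at hy ⊢
      rcases hy with rfl | rfl | rfl | rfl <;> simp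
    · exact h
  have key : ∀ m n : ZMod 4, m * x1.1.e + n * x1.2.e = 0 → HasSec c S (trRep m n) := by
    intro m n hmn
    refine hfix _ 0 ?_
    intro y hy
    show m * y.1.e + n * y.2.e + 0 = 0
    simp only [List.mem_cons, List.not_mem_nil, or_false] at hy
    rcases hy with rfl | rfl | rfl | rfl
    · rw [hmn, add_zero]
    · rw [f1.2.2, f2.2.2]; linear_combination -hmn
    · rw [f1.1, f2.1]; simp
    · rw [f1.2.1, f2.2.1]; simp
  have n1 : 2 * x1.1.e + 0 * x1.2.e ≠ 0 := fun h => h20 (key _ _ h)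
  have n2 : 0 * x1.1.e + 2 * x1.2.e ≠ 0 := fun h => h02 (key _ _ h)
  have n3 : 2 * x1.1.e + 2 * x1.2.e ≠ 0 := fun h => h22 (key _ _ h)
  have : ∀ a b : ZMod 4, 2 * a + 0 * b ≠ 0 → 0 * a + 2 * b ≠ 0 → 2 * a + 2 * b = 0 := by decide
  exact n3 (this _ _ n1 n2)

end FiniteAlgebra

end Part6

section Part7

open Filter Topology

section Equivalence

/-- `g` is carried to `h` by the given signed permutation. -/
def EqBy (ρ : Equiv.Perm (Fin 3)) (ε : Fin 3 → Bool) (g h : Gluing) : Prop :=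
  (∀ F, h.face (symMapFace ρ ε F) = symMapFace ρ ε (g.face F)) ∧
    (∀ F, h.axisMap (symMapFace ρ ε F) = ρ * g.axisMap F * ρ⁻¹)

theorem symMapFace_left (ρ : Equiv.Perm (Fin 3)) (ε : Fin 3 → Bool) (F : OctFace) :
    symMapFace ρ⁻¹ (fun i => ε (ρ⁻¹ i)) (symMapFace ρ ε F) = F := by
  funext j
  simp [symMapFace]

theorem symMapFace_right (ρ : Equiv.Perm (Fin 3)) (ε : Fin 3 → Bool) (F : OctFace) :
    symMapFace ρ ε (symMapFace ρ⁻¹ (fun i => ε (ρ⁻¹ i)) F) = F := by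
  funext j
  simp [symMapFace]

theorem EqBy.symm {ρ : Equiv.Perm (Fin 3)} {ε : Fin 3 → Bool} {g h : Gluing}
    (H : EqBy ρ ε g h) : EqBy ρ⁻¹ (fun i => ε (ρ⁻¹ i)) h g := by
  constructor
  · intro F
    have := H.1 (symMapFace ρ⁻¹ (fun i => ε (ρ⁻¹ i)) F)
    rw [symMapFace_right] at this
    rw [this, symMapFace_left]
  · intro F
    have := H.2 (symMapFace ρ⁻¹ (fun i => ε (ρ⁻¹ i)) F)
    rw [symMapFace_right] at this
    rw [this]
    group

theorem equivGluing_refl (g : Gluing) : EquivGluing g g := by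
  refine ⟨1, fun _ => false, ?_, ?_⟩
  · intro F
    have : ∀ F, symMapFace 1 (fun _ => false) F = F := by
      intro F; funext j; simp [symMapFace]
    rw [this, this]
  · intro F
    have : ∀ F, symMapFace 1 (fun _ => false) F = F := by
      intro F; funext j; simp [symMapFace]
    rw [this]; simp

theorem equivGluing_symm {g h : Gluing} (H : EquivGluing g h) : EquivGluing h g := by
  obtain ⟨ρ, ε, H⟩ := H
  exact ⟨_, _, EqBy.symm (ρ := ρ) (ε := ε) H⟩

theorem equivGluing_trans {g h k : Gluing} (H : EquivGluing g h) (K : EquivGluing h k) :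
    EquivGluing g k := by
  obtain ⟨ρ, ε, H1, H2⟩ := H
  obtain ⟨ρ', ε', K1, K2⟩ := K
  have hc : ∀ F, symMapFace (ρ' * ρ) (fun i => Bool.xor (ε i) (ε' (ρ i))) F =
      symMapFace ρ' ε' (symMapFace ρ ε F) := by
    intro F; funext j; simp [symMapFace, mul_inv_rev]
  refine ⟨ρ' * ρ, fun i => Bool.xor (ε i) (ε' (ρ i)), ?_, ?_⟩
  · intro F
    rw [hc, hc, K1, H1]
  · intro F
    rw [hc, K2, H2]; group

theorem orbit_eq_iff (g h : Gluing) : orbit g = orbit h ↔ EquivGluing g h := by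
  constructor
  · intro H
    have : h ∈ orbit h := equivGluing_refl h
    rw [← H] at this
    exact this
  · intro H
    ext k
    exact ⟨fun K => equivGluing_trans (equivGluing_symm H) K, fun K => equivGluing_trans H K⟩

/-- The linear map of a signed permutation. -/
def symLin (ρ : Equiv.Perm (Fin 3)) (ε : Fin 3 → Bool) : (Fin 3 → ℝ) →ₗ[ℝ] (Fin 3 → ℝ) where
  toFun x := fun j => (if ε (ρ⁻¹ j) then -1 else 1) * x (ρ⁻¹ j)
  map_add' x y := by funext j; simp [mul_add]
  map_smul' a x := by funext j; simp

theorem symLin_apply (ρ : Equiv.Perm (Fin 3)) (ε : Fin 3 → Bool) (x : Fin 3 → ℝ) (j : Fin 3) :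
    symLin ρ ε x j = (if ε (ρ⁻¹ j) then -1 else 1) * x (ρ⁻¹ j) := rfl

theorem symLin_vertexPt (ρ : Equiv.Perm (Fin 3)) (ε : Fin 3 → Bool) (i : Fin 3) (b : Bool) :
    symLin ρ ε (vertexPt (i, b)) = vertexPt (ρ i, Bool.xor b (ε i)) := by
  funext j
  rw [symLin_apply]
  by_cases h : j = ρ i
  · subst h
    cases b <;> cases he : ε i <;> simp [vertexPt, he]
  · have h' : ρ⁻¹ j ≠ i := by
      intro h2; apply h; rw [← h2]; simp
    simp only [vertexPt, if_neg h, if_neg h', mul_zero]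

theorem symLin_left (ρ : Equiv.Perm (Fin 3)) (ε : Fin 3 → Bool) (x : Fin 3 → ℝ) :
    symLin ρ⁻¹ (fun i => ε (ρ⁻¹ i)) (symLin ρ ε x) = x := by
  funext j
  simp only [symLin_apply]
  cases h : ε j <;> simp [h]

theorem symLin_right (ρ : Equiv.Perm (Fin 3)) (ε : Fin 3 → Bool) (x : Fin 3 → ℝ) :
    symLin ρ ε (symLin ρ⁻¹ (fun i => ε (ρ⁻¹ i)) x) = x := by
  funext j
  simp only [symLin_apply]
  cases h : ε (ρ.symm j) <;> simp [h]

theorem symLin_mem (ρ : Equiv.Perm (Fin 3)) (ε : Fin 3 → Bool) {x : Fin 3 → ℝ}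
    (hx : x ∈ SolidOcta) : symLin ρ ε x ∈ SolidOcta := by
  have : symLin ρ ε x ∈ symLin ρ ε '' (convexHull ℝ (Set.range vertexPt)) := ⟨x, hx, rfl⟩
  rw [LinearMap.image_convexHull] at this
  refine convexHull_mono ?_ this
  rintro _ ⟨_, ⟨⟨i, b⟩, rfl⟩, rfl⟩
  exact ⟨_, (symLin_vertexPt ρ ε i b).symm⟩

/-- The self-map of the solid octahedron given by a signed permutation. -/
def symOcta (ρ : Equiv.Perm (Fin 3)) (ε : Fin 3 → Bool) (x : SolidOcta) : SolidOcta :=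
  ⟨symLin ρ ε x, symLin_mem ρ ε x.2⟩

theorem continuous_symOcta (ρ : Equiv.Perm (Fin 3)) (ε : Fin 3 → Bool) :
    Continuous (symOcta ρ ε) :=
  ((LinearMap.continuous_of_finiteDimensional _).comp continuous_subtype_val).subtype_mk _

theorem EqBy.rel {ρ : Equiv.Perm (Fin 3)} {ε : Fin 3 → Bool} {g h : Gluing}
    (H : EqBy ρ ε g h) {x y : SolidOcta} (hxy : glueRel g x y) :
    glueRel h (symOcta ρ ε x) (symOcta ρ ε y) := by
  obtain ⟨F, w, hw, hs, hx, hy⟩ := hxy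
  refine ⟨symMapFace ρ ε F, fun j => w (ρ⁻¹ j), fun i => hw _, ?_, ?_, ?_⟩
  · rw [← hs]; exact Equiv.sum_comp ρ⁻¹ w
  · show symLin ρ ε x = _
    rw [hx, map_sum]
    conv_rhs => rw [← Equiv.sum_comp ρ]
    refine Finset.sum_congr rfl fun i _ => ?_
    rw [map_smul, symLin_vertexPt]
    simp [symMapFace]
  · show symLin ρ ε y = _
    rw [hy, map_sum]
    conv_rhs => rw [← Equiv.sum_comp ρ]
    refine Finset.sum_congr rfl fun i _ => ?_
    rw [map_smul, symLin_vertexPt, H.1, H.2]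
    simp [symMapFace]

theorem EqBy.eqv {ρ : Equiv.Perm (Fin 3)} {ε : Fin 3 → Bool} {g h : Gluing}
    (H : EqBy ρ ε g h) {x y : SolidOcta} (hxy : Relation.EqvGen (glueRel g) x y) :
    Relation.EqvGen (glueRel h) (symOcta ρ ε x) (symOcta ρ ε y) := by
  induction hxy with
  | rel x y h => exact .rel _ _ (H.rel h)
  | refl x => exact .refl _
  | symm x y _ ih => exact .symm _ _ ih
  | trans x y z _ _ ih1 ih2 => exact .trans _ _ _ ih1 ih2

/-- The induced map of quotient spaces. -/
def EqBy.map {ρ : Equiv.Perm (Fin 3)} {ε : Fin 3 → Bool} {g h : Gluing}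
    (H : EqBy ρ ε g h) : XSpace g → XSpace h :=
  Quotient.map (symOcta ρ ε) (fun _ _ hxy => H.eqv hxy)

theorem EqBy.continuous_map {ρ : Equiv.Perm (Fin 3)} {ε : Fin 3 → Bool} {g h : Gluing}
    (H : EqBy ρ ε g h) : Continuous H.map :=
  (continuous_symOcta ρ ε).quotient_map' _

theorem equivGluing_homeo {g h : Gluing} (H : EquivGluing g h) :
    Nonempty (XSpace g ≃ₜ XSpace h) := by
  obtain ⟨ρ, ε, H⟩ := H
  have H : EqBy ρ ε g h := H
  refine ⟨⟨⟨H.map, H.symm.map, ?_, ?_⟩, H.continuous_map, H.symm.continuous_map⟩⟩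
  · intro x
    induction x using Quotient.inductionOn with
    | h a =>
      show (Quotient.mk _ _ : XSpace g) = _
      congr 1
      exact Subtype.ext (symLin_left ρ ε a)
  · intro x
    induction x using Quotient.inductionOn with
    | h a =>
      show (Quotient.mk _ _ : XSpace h) = _
      congr 1
      exact Subtype.ext (symLin_right ρ ε a)

theorem not_equiv_AB : ¬ EquivGluing gA gB := by
  intro H
  obtain ⟨f⟩ := equivGluing_homeo H
  exact not_pinv_gB (pinv_gA.homeo f)

/-- Reduction of the main theorem to the combinatorial classification. -/
theorem main_of_classification (hA : LinksGenusTwoTorus gA) (hB : LinksGenusTwoTorus gB)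
    (hcl : ∀ g, LinksGenusTwoTorus g → EquivGluing g gA ∨ EquivGluing g gB) :
    Nat.card {s : Set Gluing // ∃ g : Gluing, LinksGenusTwoTorus g ∧ s = orbit g} = 2 ∧
    ∀ g h : Gluing, LinksGenusTwoTorus g → LinksGenusTwoTorus h →
      Nonempty (XSpace g ≃ₜ XSpace h) → EquivGluing g h := by
  constructor
  · have hset : {s : Set Gluing | ∃ g : Gluing, LinksGenusTwoTorus g ∧ s = orbit g} =
        {orbit gA, orbit gB} := by
      ext s
      constructor
      · rintro ⟨g, hg, rfl⟩
        rcases hcl g hg with h | h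
        · exact Or.inl ((orbit_eq_iff _ _).2 h)
        · exact Or.inr ((orbit_eq_iff _ _).2 h)
      · rintro (h | h)
        · exact ⟨gA, hA, h⟩
        · exact ⟨gB, hB, h⟩
    have hne : orbit gA ≠ orbit gB := fun h => not_equiv_AB ((orbit_eq_iff _ _).1 h)
    change Nat.card ({s : Set Gluing | ∃ g : Gluing, LinksGenusTwoTorus g ∧ s = orbit g} :
      Set (Set Gluing)) = 2
    rw [hset, Nat.card_coe_set_eq]
    exact Set.ncard_pair hne
  · rintro g h hg hh ⟨f⟩
    rcases hcl g hg with a | a <;> rcases hcl h hh with b | b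
    · exact equivGluing_trans a (equivGluing_symm b)
    · exfalso
      obtain ⟨p⟩ := equivGluing_homeo a
      obtain ⟨q⟩ := equivGluing_homeo b
      exact not_pinv_gB (pinv_gA.homeo ((p.symm.trans f).trans q))
    · exfalso
      obtain ⟨p⟩ := equivGluing_homeo a
      obtain ⟨q⟩ := equivGluing_homeo b
      exact not_pinv_gB (pinv_gA.homeo ((q.symm.trans f.symm).trans p))
    · exact equivGluing_trans a (equivGluing_symm b)

end Equivalence

end Part7


section SearchDefs

/-! A kernel-friendly exhaustive search.  Everything is phrased with recursors and the basic
operations on natural numbers. -/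

noncomputable section

def iteR {α : Type} (b : Bool) (x y : α) : α := @Bool.rec (fun _ => α) y x b

def mapR {α β : Type} (f : α → β) (l : List α) : List β :=
  @List.rec α (fun _ => List β) [] (fun h _ ih => f h :: ih) l

def allR {α : Type} (l : List α) (f : α → Bool) : Bool :=
  @List.rec α (fun _ => Bool) true (fun h _ ih => iteR (f h) ih false) l

def anyR {α : Type} (l : List α) (f : α → Bool) : Bool :=
  @List.rec α (fun _ => Bool) false (fun h _ ih => iteR (f h) true ih) l

def filR (l : List ℕ) (f : ℕ → Bool) : List ℕ :=
  @List.rec ℕ (fun _ => List ℕ) [] (fun h _ ih => iteR (f h) (h :: ih) ih) l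

def cntR (l : List ℕ) (f : ℕ → Bool) : ℕ :=
  @List.rec ℕ (fun _ => ℕ) 0 (fun h _ ih => iteR (f h) (Nat.succ ih) ih) l

def getR (l : List ℕ) : ℕ → ℕ :=
  @List.rec ℕ (fun _ => ℕ → ℕ) (fun _ => 0)
    (fun h _ ih n => @Nat.rec (fun _ => ℕ) h (fun m _ => ih m) n) l

/-- Identify two labels. -/
def mergeR (l : List ℕ) (a b : ℕ) : List ℕ :=
  mapR (fun c => iteR (Nat.beq c (getR l b)) (getR l a) c) l

def mergeAllR (P : List (ℕ × ℕ)) : List ℕ → List ℕ :=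
  @List.rec (ℕ × ℕ) (fun _ => List ℕ → List ℕ) (fun l => l)
    (fun p _ ih l => ih (mergeR l p.1 p.2)) P

/-- The code of the vertex on axis `i` of the face with code `a`. -/
def vxR (a i : ℕ) : ℕ := Nat.add (Nat.mul 2 i) (Nat.mod (Nat.shiftRight a i) 2)

def pmR (k i : ℕ) : ℕ := Nat.mod (Nat.shiftRight k (Nat.mul 2 i)) 4

def ecR (a i j : ℕ) : ℕ := Nat.add (Nat.mul (vxR a i) 4)
  (Nat.add (Nat.mul (Nat.sub (Nat.mod (Nat.sub (Nat.add j 3) i) 3) 1) 2)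
    (Nat.mod (Nat.shiftRight a j) 2))

/-- Vertex identifications of a face identification (in codes). -/
def vpR (a b k : ℕ) : List (ℕ × ℕ) :=
  mapR (fun i => (vxR a i, vxR b (pmR k i))) [0, 1, 2]

/-- Edge-end identifications of a face identification (in codes). -/
def epR (a b k : ℕ) : List (ℕ × ℕ) :=
  mapR (fun q => (ecR a q.1 q.2, ecR b (pmR k q.1) (pmR k q.2)))
    [(0, 1), (0, 2), (1, 0), (1, 2), (2, 0), (2, 1)]

/-- All labels agree: there is only one vertex class. -/
def oneR (vl : List ℕ) : Bool := allR vl fun c => Nat.beq c (getR vl 0)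

def vl0 : List ℕ := [0, 1, 2, 3, 4, 5]

def el0 : List ℕ := [0, 1, 2, 3, 4, 5, 6, 7, 8, 9, 10, 11, 12, 13, 14, 15, 16, 17, 18, 19, 20,
  21, 22, 23]

/-- Number of vertices with label `r`. -/
def nV (vl : List ℕ) (r : ℕ) : ℕ := cntR vl0 (fun u => Nat.beq (getR vl u) r)

/-- Number of classes of edge-ends based at vertices with label `r`. -/
def nE (vl re : List ℕ) (r : ℕ) : ℕ := cntR re (fun e => Nat.beq (getR vl (Nat.div e 4)) r)

def rootsR (el base : List ℕ) : List ℕ := filR base (fun e => Nat.beq (getR el e) e)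

def linksR (vl re : List ℕ) : Bool :=
  iteR (anyR vl (fun r => Nat.beq (nE vl re r) (nV vl r)))
    (anyR vl (fun r => Nat.beq (Nat.add (nE vl re r) 2) (nV vl r))) false

def parR (a : ℕ) : ℕ :=
  Nat.mod (Nat.add a (Nat.add (Nat.shiftRight a 1) (Nat.shiftRight a 2))) 2

def allowedR (a b : ℕ) : List ℕ :=
  iteR (Nat.beq (parR a) (parR b)) [33, 6, 24] [36, 9, 18]

def symR (r e a : ℕ) : ℕ :=
  Nat.add (Nat.shiftLeft (Nat.mod (Nat.add a e) 2) (pmR r 0))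
    (Nat.add
      (Nat.shiftLeft (Nat.mod (Nat.add (Nat.shiftRight a 1) (Nat.shiftRight e 1)) 2) (pmR r 1))
      (Nat.shiftLeft (Nat.mod (Nat.add (Nat.shiftRight a 2) (Nat.shiftRight e 2)) 2) (pmR r 2)))

def conjR (r k k' : ℕ) : Bool :=
  allR [0, 1, 2] fun i => Nat.beq (pmR k' (pmR r i)) (pmR r (pmR k i))

/-- Does the symmetry `(r, e)` carry the triple `t` to the pattern with tables `T`, `T'`? -/
def chkR (T T' : List ℕ) (r e : ℕ) (t : ℕ × ℕ × ℕ) : Bool :=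
  iteR (Nat.beq (getR T (symR r e t.1)) (symR r e t.2.1))
    (conjR r t.2.2 (getR T' (symR r e t.1))) false

def eqvR (T T' : List ℕ) (acc : List (ℕ × ℕ × ℕ)) : Bool :=
  anyR [36, 9, 18, 33, 6, 24] fun r => anyR [0, 1, 2, 3, 4, 5, 6, 7] fun e =>
    allR acc (chkR T T' r e)

def leafR (T A B : List ℕ) (acc : List (ℕ × ℕ × ℕ)) (vl re : List ℕ) : Bool :=
  iteR (linksR vl re) (iteR (eqvR T A acc) true (eqvR T B acc)) true

def searchR (T A B : List ℕ) (n : ℕ) :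
    List ℕ → List (ℕ × ℕ × ℕ) → List ℕ → List ℕ → Bool :=
  @Nat.rec (fun _ => List ℕ → List (ℕ × ℕ × ℕ) → List ℕ → List ℕ → Bool)
    (fun rem acc vl el => @List.rec ℕ (fun _ => Bool) (leafR T A B acc vl (rootsR el el0))
      (fun _ _ _ => false) rem)
    (fun _ ih rem acc vl el => @List.rec ℕ (fun _ => Bool) false (fun a rest _ =>
      allR rest fun b => allR (allowedR a b) fun k =>
        iteR (oneR (mergeAllR (vpR a b k) vl)) true
          (ih (filR rest fun c => iteR (Nat.beq c b) false true) ((a, b, k) :: acc)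
            (mergeAllR (vpR a b k) vl) (mergeAllR (epR a b k) el))) rem) n

/-- The tables of the two patterns. -/
def tabF : List ℕ := [4, 7, 6, 5, 0, 3, 2, 1]
def tabA : List ℕ := [9, 24, 9, 24, 18, 24, 18, 24]
def tabB : List ℕ := [9, 24, 18, 24, 18, 24, 9, 24]

theorem search_true :
    searchR tabF tabA tabB 4 [0, 1, 2, 3, 4, 5, 6, 7] [] vl0 el0 = true := by decide +kernel

end

end SearchDefs


section SearchSound

theorem iteR_eq {α : Type} (b : Bool) (x y : α) : iteR b x y = if b = true then x else y := by
  cases b <;> rfl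

theorem mapR_eq {α β : Type} (f : α → β) (l : List α) : mapR f l = l.map f := by
  induction l with
  | nil => rfl
  | cons a t ih => rw [List.map_cons, ← ih]; rfl

theorem allR_iff {α : Type} (l : List α) (f : α → Bool) :
    allR l f = true ↔ ∀ x ∈ l, f x = true := by
  induction l with
  | nil => simp [allR]
  | cons a t ih =>
    have : allR (a :: t) f = iteR (f a) (allR t f) false := rfl
    rw [this, iteR_eq, List.forall_mem_cons, ← ih]
    cases f a <;> simp

theorem anyR_iff {α : Type} (l : List α) (f : α → Bool) :
    anyR l f = true ↔ ∃ x ∈ l, f x = true := by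
  induction l with
  | nil => simp [anyR]
  | cons a t ih =>
    have : anyR (a :: t) f = iteR (f a) true (anyR t f) := rfl
    rw [this, iteR_eq, List.exists_mem_cons_iff, ← ih]
    cases f a <;> simp

theorem filR_eq (l : List ℕ) (f : ℕ → Bool) : filR l f = l.filter f := by
  induction l with
  | nil => rfl
  | cons a t ih =>
    have : filR (a :: t) f = iteR (f a) (a :: filR t f) (filR t f) := rfl
    rw [this, iteR_eq, List.filter_cons, ih]

theorem cntR_eq (l : List ℕ) (f : ℕ → Bool) : cntR l f = l.countP f := by
  induction l with
  | nil => rfl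
  | cons a t ih =>
    have : cntR (a :: t) f = iteR (f a) (cntR t f + 1) (cntR t f) := rfl
    rw [this, iteR_eq, List.countP_cons, ih]
    split_ifs <;> rfl

theorem cntR_card (l : List ℕ) (hl : l.Nodup) (f : ℕ → Bool) :
    cntR l f = (l.toFinset.filter (fun x => f x = true)).card := by
  rw [cntR_eq, List.countP_eq_length_filter, ← List.toFinset_card_of_nodup (hl.filter _),
    List.toFinset_filter]

theorem getR_eq (l : List ℕ) (n : ℕ) : getR l n = l.getD n 0 := by
  induction l generalizing n with
  | nil => simp [getR]
  | cons a t ih =>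
    cases n with
    | zero => simp [getR]
    | succ n =>
      have : getR (a :: t) (n + 1) = getR t n := rfl
      rw [this, ih]; simp

theorem getR_mem (l : List ℕ) (n : ℕ) (h : n < l.length) : getR l n ∈ l := by
  rw [getR_eq, List.getD_eq_getElem _ _ h]; exact List.getElem_mem h

theorem getR_merge (l : List ℕ) (a b n : ℕ) (h : n < l.length) :
    getR (mergeR l a b) n = if getR l n = getR l b then getR l a else getR l n := by
  rw [getR_eq (mergeR l a b), mergeR, mapR_eq, List.getD_eq_getElem _ _ (by simpa using h),
    List.getElem_map, iteR_eq, getR_eq l n, List.getD_eq_getElem _ _ h]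
  simp only [Nat.beq_eq]

/-- A list of labels for the equivalence relation generated by a list of pairs. -/
structure Lab (n : ℕ) (R : ℕ → ℕ → Prop) (L : List (ℕ × ℕ)) (l : List ℕ) : Prop where
  len : l.length = n
  bd : ∀ p ∈ L, p.1 < n ∧ p.2 < n
  lt : ∀ a < n, getR l a < n
  idem : ∀ a < n, getR l (getR l a) = getR l a
  sound : ∀ a < n, ∀ b < n, getR l a = getR l b → R a b
  compl : ∀ p ∈ L, getR l p.1 = getR l p.2

theorem Lab.sub {n : ℕ} {R : ℕ → ℕ → Prop} {L L' : List (ℕ × ℕ)} {l : List ℕ}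
    (h : Lab n R L l) (hs : ∀ p ∈ L', p ∈ L) : Lab n R L' l :=
  ⟨h.len, fun p hp => h.bd p (hs p hp), h.lt, h.idem, h.sound, fun p hp => h.compl p (hs p hp)⟩

theorem Lab.merge {n : ℕ} {R : ℕ → ℕ → Prop} (hR : Equivalence R) {L : List (ℕ × ℕ)}
    {l : List ℕ} (h : Lab n R L l) {a b : ℕ} (ha : a < n) (hb : b < n) (hab : R a b) :
    Lab n R ((a, b) :: L) (mergeR l a b) := by
  have key : ∀ c < n, getR (mergeR l a b) c =
      if getR l c = getR l b then getR l a else getR l c := by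
    intro c hc
    exact getR_merge l a b c (by rw [h.len]; exact hc)
  have hlen : (mergeR l a b).length = n := by rw [mergeR, mapR_eq, List.length_map, h.len]
  have hlt : ∀ c < n, getR (mergeR l a b) c < n := by
    intro c hc
    rw [key c hc]
    split_ifs
    · exact h.lt a ha
    · exact h.lt c hc
  refine ⟨hlen, ?_, hlt, ?_, ?_, ?_⟩
  · intro p hp
    rcases List.mem_cons.1 hp with rfl | hp
    · exact ⟨ha, hb⟩
    · exact h.bd p hp
  · intro c hc
    rw [key c hc]
    split_ifs with h1
    · rw [key _ (h.lt a ha), h.idem a ha]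
      split_ifs <;> rfl
    · rw [key _ (h.lt c hc), h.idem c hc, if_neg h1]
  · intro c hc d hd hcd
    rw [key c hc, key d hd] at hcd
    split_ifs at hcd with h1 h2 h2
    · exact h.sound c hc d hd (h1.trans h2.symm)
    · exact hR.trans (h.sound c hc b hb h1) (hR.trans (hR.symm hab) (h.sound a ha d hd hcd))
    · exact hR.trans (h.sound c hc a ha hcd) (hR.trans hab (h.sound b hb d hd h2.symm))
    · exact h.sound c hc d hd hcd
  · intro p hp
    rcases List.mem_cons.1 hp with rfl | hp
    · show getR _ a = getR _ b
      rw [key a ha, key b hb, if_pos rfl]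
      split_ifs <;> rfl
    · rw [key _ (h.bd p hp).1, key _ (h.bd p hp).2, h.compl p hp]

theorem Lab.mergeAll {n : ℕ} {R : ℕ → ℕ → Prop} (hR : Equivalence R) (P : List (ℕ × ℕ))
    (hP : ∀ p ∈ P, p.1 < n ∧ p.2 < n ∧ R p.1 p.2) {L : List (ℕ × ℕ)} {l : List ℕ}
    (h : Lab n R L l) : Lab n R (P ++ L) (mergeAllR P l) := by
  induction P generalizing L l with
  | nil => exact h
  | cons q t ih =>
    obtain ⟨h1, h2, h3⟩ := hP q (by simp)
    have := ih (fun p hp => hP p (by simp [hp])) (h.merge hR h1 h2 h3)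
    refine Lab.sub (this : Lab n R _ (mergeAllR (q :: t) l)) ?_
    intro p hp
    simp only [List.cons_append, List.mem_cons, List.mem_append] at hp ⊢
    tauto

def fcode (F : OctFace) : ℕ := (F 0).toNat + 2 * (F 1).toNat + 4 * (F 2).toNat
def pcode (π : Equiv.Perm (Fin 3)) : ℕ := (π 0).val + 4 * (π 1).val + 16 * (π 2).val
def vcode (v : OctVertex) : ℕ := 2 * v.1.val + v.2.toNat
def ecodeP (p : OctVertex × OctVertex) : ℕ :=
  vcode p.1 * 4 + (((p.2.1.val + 3 - p.1.1.val) % 3 - 1) * 2 + p.2.2.toNat)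
def ecode (p : EdgeEnd) : ℕ := ecodeP p.1

theorem fcode_inj : ∀ F F' : OctFace, fcode F = fcode F' → F = F' := by decide +kernel
theorem vcode_inj : Function.Injective vcode := by
  have : ∀ v w : OctVertex, vcode v = vcode w → v = w := by decide +kernel
  exact fun v w h => this v w h
theorem ecode_inj : Function.Injective ecode := by
  have : ∀ v w : EdgeEnd, ecode v = ecode w → v = w := by decide +kernel
  exact fun v w h => this v w h
theorem vcode_lt : ∀ v, vcode v < 6 := by decide +kernel
theorem ecode_lt : ∀ p, ecode p < 24 := by decide +kernel
theorem ecode_surj : ∀ n < 24, ∃ p, ecode p = n := by decide +kernel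
theorem ecode_div : ∀ p : EdgeEnd, ecode p / 4 = vcode p.1.1 := by decide +kernel

theorem vpR_eq : ∀ (F F' : OctFace) (π : Equiv.Perm (Fin 3)),
    vpR (fcode F) (fcode F') (pcode π) =
      [(0 : Fin 3), 1, 2].map fun i => (vcode (i, F i), vcode (π i, F' (π i))) := by
  decide +kernel

theorem epR_eq : ∀ (F F' : OctFace) (π : Equiv.Perm (Fin 3)),
    epR (fcode F) (fcode F') (pcode π) =
      [((0 : Fin 3), (1 : Fin 3)), (0, 2), (1, 0), (1, 2), (2, 0), (2, 1)].map fun q =>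
        (ecodeP ((q.1, F q.1), (q.2, F q.2)),
          ecodeP ((π q.1, F' (π q.1)), (π q.2, F' (π q.2)))) := by
  decide +kernel

theorem allowedR_mem : ∀ (F F' : OctFace) (π : Equiv.Perm (Fin 3)),
    (Equiv.Perm.sign π = 1 ↔ faceSign F ≠ faceSign F') →
      pcode π ∈ allowedR (fcode F) (fcode F') := by decide +kernel

theorem symR_eq : ∀ (ρ : Equiv.Perm (Fin 3)) (ε F : OctFace),
    symR (pcode ρ) (fcode ε) (fcode F) = fcode (symMapFace ρ ε F) := by decide +kernel

theorem pmR_eq : ∀ (π : Equiv.Perm (Fin 3)) (i : Fin 3), pmR (pcode π) i.val = (π i).val := by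
  decide +kernel

theorem pcode_surj : ∀ r ∈ [36, 9, 18, 33, 6, 24], ∃ π, pcode π = r := by decide +kernel

theorem fcode_surj : ∀ r ∈ [0, 1, 2, 3, 4, 5, 6, 7], ∃ F, fcode F = r := by decide +kernel

theorem fcode_mem : ∀ F, fcode F ∈ [0, 1, 2, 3, 4, 5, 6, 7] := by decide +kernel

end SearchSound


section Classification

noncomputable section

instance : Nonempty EdgeEnd := ⟨⟨((0, true), (1, true)), by decide⟩⟩

def vdec : ℕ → OctVertex := Function.invFun vcode
def edec : ℕ → EdgeEnd := Function.invFun ecode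

theorem vdec_vcode (v : OctVertex) : vdec (vcode v) = v := Function.leftInverse_invFun vcode_inj v
theorem edec_ecode (v : EdgeEnd) : edec (ecode v) = v := Function.leftInverse_invFun ecode_inj v

def RV (g : Gluing) (a b : ℕ) : Prop := Relation.EqvGen (vtxRel g) (vdec a) (vdec b)
def RE (g : Gluing) (a b : ℕ) : Prop := Relation.EqvGen (endRel g) (edec a) (edec b)

theorem RV_equiv (g : Gluing) : Equivalence (RV g) :=
  ⟨fun _ => .refl _, fun h => .symm _ _ h, fun h k => .trans _ _ _ h k⟩
theorem RE_equiv (g : Gluing) : Equivalence (RE g) :=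
  ⟨fun _ => .refl _, fun h => .symm _ _ h, fun h k => .trans _ _ _ h k⟩

def tri (g : Gluing) (F : OctFace) : ℕ × ℕ × ℕ :=
  (fcode F, fcode (g.face F), pcode (g.axisMap F))

def vpT (t : ℕ × ℕ × ℕ) : List (ℕ × ℕ) := vpR t.1 t.2.1 t.2.2
def epT (t : ℕ × ℕ × ℕ) : List (ℕ × ℕ) := epR t.1 t.2.1 t.2.2

theorem mem_vpT (g : Gluing) (F : OctFace) (q : ℕ × ℕ) : q ∈ vpT (tri g F) ↔
    ∃ i, q = (vcode (i, F i), vcode (g.axisMap F i, g.face F (g.axisMap F i))) := by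
  show q ∈ vpR (fcode F) (fcode (g.face F)) (pcode (g.axisMap F)) ↔ _
  rw [vpR_eq, List.mem_map]
  constructor
  · rintro ⟨i, -, rfl⟩; exact ⟨i, rfl⟩
  · rintro ⟨i, rfl⟩; exact ⟨i, by fin_cases i <;> simp, rfl⟩

theorem mem_epT (g : Gluing) (F : OctFace) (q : ℕ × ℕ) : q ∈ epT (tri g F) ↔
    ∃ i j, i ≠ j ∧ q = (ecodeP ((i, F i), (j, F j)),
      ecodeP ((g.axisMap F i, g.face F (g.axisMap F i)),
        (g.axisMap F j, g.face F (g.axisMap F j)))) := by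
  show q ∈ epR (fcode F) (fcode (g.face F)) (pcode (g.axisMap F)) ↔ _
  rw [epR_eq, List.mem_map]
  constructor
  · rintro ⟨⟨i, j⟩, hij, rfl⟩
    refine ⟨i, j, ?_, rfl⟩
    revert hij; revert i j; decide
  · rintro ⟨i, j, hij, rfl⟩
    refine ⟨(i, j), ?_, rfl⟩
    revert hij; revert i j; decide

theorem vpT_ok (g : Gluing) (F : OctFace) :
    ∀ p ∈ vpT (tri g F), p.1 < 6 ∧ p.2 < 6 ∧ RV g p.1 p.2 := by
  intro p hp
  obtain ⟨i, rfl⟩ := (mem_vpT g F p).1 hp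
  refine ⟨vcode_lt _, vcode_lt _, ?_⟩
  show Relation.EqvGen _ _ _
  rw [vdec_vcode, vdec_vcode]
  exact .rel _ _ ⟨F, i, rfl, rfl⟩

theorem epT_ok (g : Gluing) (F : OctFace) :
    ∀ p ∈ epT (tri g F), p.1 < 24 ∧ p.2 < 24 ∧ RE g p.1 p.2 := by
  intro p hp
  obtain ⟨i, j, hij, rfl⟩ := (mem_epT g F p).1 hp
  have e1 := ecode_lt ⟨((i, F i), (j, F j)), hij⟩
  have e2 := ecode_lt ⟨((g.axisMap F i, g.face F (g.axisMap F i)),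
        (g.axisMap F j, g.face F (g.axisMap F j))), fun h => hij ((g.axisMap F).injective h)⟩
  refine ⟨e1, e2, ?_⟩
  have : RE g (ecode ⟨((i, F i), (j, F j)), hij⟩)
      (ecode ⟨((g.axisMap F i, g.face F (g.axisMap F i)),
        (g.axisMap F j, g.face F (g.axisMap F j))), fun h => hij ((g.axisMap F).injective h)⟩) := by
    show Relation.EqvGen _ _ _
    rw [edec_ecode, edec_ecode]
    exact .rel _ _ ⟨F, i, j, hij, rfl, rfl⟩
  exact this

/-- All faces are covered by the list of triples. -/
def Full (g : Gluing) (acc : List (ℕ × ℕ × ℕ)) : Prop :=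
  ∀ F, tri g F ∈ acc ∨ tri g (g.face F) ∈ acc

theorem labV_iff {g : Gluing} {acc : List (ℕ × ℕ × ℕ)} {vl : List ℕ} (hf : Full g acc)
    (h : Lab 6 (RV g) (acc.flatMap vpT) vl) (u w : OctVertex) :
    getR vl (vcode u) = getR vl (vcode w) ↔ Relation.EqvGen (vtxRel g) u w := by
  constructor
  · intro hl
    have := h.sound _ (vcode_lt u) _ (vcode_lt w) hl
    unfold RV at this
    rwa [vdec_vcode, vdec_vcode] at this
  · intro hr
    induction hr with
    | refl => rfl
    | symm _ _ _ ih => exact ih.symm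
    | trans _ _ _ _ _ ih1 ih2 => exact ih1.trans ih2
    | rel x y hxy =>
      obtain ⟨F, i, rfl, rfl⟩ := hxy
      rcases hf F with ht | ht
      · exact h.compl (_, _) (List.mem_flatMap.2 ⟨_, ht, (mem_vpT g F _).2 ⟨i, rfl⟩⟩)
      · refine (h.compl (vcode (g.axisMap F i, g.face F (g.axisMap F i)), vcode (i, F i))
          (List.mem_flatMap.2 ⟨_, ht, (mem_vpT g _ _).2
          ⟨g.axisMap F i, ?_⟩⟩)).symm
        rw [gl_axis_face, gl_face_face]
        simp

theorem labE_iff {g : Gluing} {acc : List (ℕ × ℕ × ℕ)} {el : List ℕ} (hf : Full g acc)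
    (h : Lab 24 (RE g) (acc.flatMap epT) el) (u w : EdgeEnd) :
    getR el (ecode u) = getR el (ecode w) ↔ Relation.EqvGen (endRel g) u w := by
  constructor
  · intro hl
    have := h.sound _ (ecode_lt u) _ (ecode_lt w) hl
    unfold RE at this
    rwa [edec_ecode, edec_ecode] at this
  · intro hr
    induction hr with
    | refl => rfl
    | symm _ _ _ ih => exact ih.symm
    | trans _ _ _ _ _ ih1 ih2 => exact ih1.trans ih2
    | rel x y hxy =>
      obtain ⟨F, i, j, hij, hx, hy⟩ := hxy
      have hx' : ecode x = ecodeP ((i, F i), (j, F j)) := by rw [ecode, hx]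
      have hy' : ecode y = ecodeP ((g.axisMap F i, g.face F (g.axisMap F i)),
        (g.axisMap F j, g.face F (g.axisMap F j))) := by rw [ecode, hy]
      rw [hx', hy']
      rcases hf F with ht | ht
      · exact h.compl (_, _) (List.mem_flatMap.2 ⟨_, ht, (mem_epT g F _).2 ⟨i, j, hij, rfl⟩⟩)
      · refine (h.compl (ecodeP ((g.axisMap F i, g.face F (g.axisMap F i)),
          (g.axisMap F j, g.face F (g.axisMap F j))), ecodeP ((i, F i), (j, F j)))
          (List.mem_flatMap.2 ⟨_, ht, (mem_epT g _ _).2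
          ⟨g.axisMap F i, g.axisMap F j, fun h => hij ((g.axisMap F).injective h), ?_⟩⟩)).symm
        rw [gl_axis_face, gl_face_face]
        simp

theorem end_to_vtx {g : Gluing} {p q : EdgeEnd} (h : Relation.EqvGen (endRel g) p q) :
    Relation.EqvGen (vtxRel g) p.1.1 q.1.1 := by
  induction h with
  | refl => exact .refl _
  | symm _ _ _ ih => exact .symm _ _ ih
  | trans _ _ _ _ _ ih1 ih2 => exact .trans _ _ _ ih1 ih2
  | rel x y hxy =>
    obtain ⟨F, i, j, hij, hx, hy⟩ := hxy
    refine .rel _ _ ⟨F, i, ?_, ?_⟩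
    · rw [hx]
    · rw [hy]

theorem mk_vtx_iff (g : Gluing) (u w : OctVertex) :
    (Quotient.mk (vtxSetoid g) u = Quotient.mk (vtxSetoid g) w) ↔
      Relation.EqvGen (vtxRel g) u w := Quotient.eq

theorem mk_end_iff (g : Gluing) (u w : EdgeEnd) :
    (Quotient.mk (endSetoid g) u = Quotient.mk (endSetoid g) w) ↔
      Relation.EqvGen (endRel g) u w := Quotient.eq

theorem classSize_eq {g : Gluing} {acc : List (ℕ × ℕ × ℕ)} {vl : List ℕ} (hf : Full g acc)
    (h : Lab 6 (RV g) (acc.flatMap vpT) vl) (v : OctVertex) :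
    classSize g (Quotient.mk (vtxSetoid g) v) = nV vl (getR vl (vcode v)) := by
  have e1 : classSize g (Quotient.mk (vtxSetoid g) v) =
      (Finset.univ.filter fun u : OctVertex => getR vl (vcode u) = getR vl (vcode v)).card := by
    unfold classSize
    refine Nat.subtype_card _ ?_
    intro u
    rw [Finset.mem_filter, labV_iff hf h, mk_vtx_iff]
    simp
  rw [e1, nV, cntR_card _ (by decide), ← Finset.card_image_of_injective _ vcode_inj]
  congr 1
  ext n
  simp only [Finset.mem_image, Finset.mem_filter, Finset.mem_univ, true_and, Nat.beq_eq,
    List.mem_toFinset]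
  constructor
  · rintro ⟨u, hu, rfl⟩
    have hm : ∀ u, vcode u ∈ vl0 := by decide +kernel
    exact ⟨hm u, hu⟩
  · rintro ⟨hn, he⟩
    have : ∀ n ∈ vl0, ∃ u, vcode u = n := by decide +kernel
    obtain ⟨u, rfl⟩ := this n hn
    exact ⟨u, he, rfl⟩

theorem mem_el0 : ∀ n, n ∈ el0 ↔ n < 24 := by
  intro n
  constructor
  · have : ∀ n ∈ el0, n < 24 := by decide
    exact this n
  · have : ∀ n < 24, n ∈ el0 := by decide
    exact this n

theorem cornerCount_eq {g : Gluing} {acc : List (ℕ × ℕ × ℕ)} {vl el : List ℕ} (hf : Full g acc)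
    (h : Lab 6 (RV g) (acc.flatMap vpT) vl) (hE : Lab 24 (RE g) (acc.flatMap epT) el)
    (v : OctVertex) :
    cornerCount g (Quotient.mk (vtxSetoid g) v) =
      nE vl (rootsR el el0) (getR vl (vcode v)) := by
  have hnd : (rootsR el el0).Nodup := by
    rw [rootsR, filR_eq]; exact List.Nodup.filter _ (by decide)
  rw [nE, cntR_card _ hnd]
  unfold cornerCount
  let f : {q : Quotient (endSetoid g) // ∃ p : EdgeEnd, Quotient.mk (endSetoid g) p = q ∧
      Quotient.mk (vtxSetoid g) p.1.1 = Quotient.mk (vtxSetoid g) v} → ℕ :=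
    fun q => Quotient.lift (fun p => getR el (ecode p))
      (fun a b hab => (labE_iff hf hE a b).2 hab) q.1
  have hinj : Function.Injective f := by
    rintro ⟨q, p, rfl, hp⟩ ⟨q', p', rfl, hp'⟩ hq
    apply Subtype.ext
    exact (mk_end_iff g p p').2 ((labE_iff hf hE p p').1 hq)
  rw [← Nat.card_range_of_injective hinj, Nat.card_coe_set_eq, ← Set.ncard_coe_finset]
  congr 1
  ext n
  simp only [Set.mem_range, Finset.coe_filter, List.mem_toFinset, Nat.beq_eq, rootsR, filR_eq,
    List.mem_filter, mem_el0, Set.mem_ofPred_eq]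
  constructor
  · rintro ⟨⟨q, p, rfl, hp⟩, rfl⟩
    show (getR el (ecode p) < 24 ∧ getR el (getR el (ecode p)) = getR el (ecode p)) ∧
      getR vl (getR el (ecode p) / 4) = _
    refine ⟨⟨hE.lt _ (ecode_lt p), hE.idem _ (ecode_lt p)⟩, ?_⟩
    obtain ⟨p', hp'⟩ := ecode_surj _ (hE.lt _ (ecode_lt p))
    rw [← hp', ecode_div, labV_iff hf h]
    have h1 : Relation.EqvGen (endRel g) p' p := by
      rw [← labE_iff hf hE, hp', hE.idem _ (ecode_lt p)]
    exact .trans _ _ _ (end_to_vtx h1) ((mk_vtx_iff g _ _).1 hp)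
  · rintro ⟨⟨hn, hr⟩, hv⟩
    obtain ⟨p, rfl⟩ := ecode_surj n hn
    rw [show (ecode p).div 4 = ecode p / 4 from rfl, ecode_div, labV_iff hf h] at hv
    exact ⟨⟨_, p, rfl, (mk_vtx_iff g _ _).2 hv⟩, hr⟩

theorem linkChi_eq {g : Gluing} {acc : List (ℕ × ℕ × ℕ)} {vl el : List ℕ} (hf : Full g acc)
    (h : Lab 6 (RV g) (acc.flatMap vpT) vl) (hE : Lab 24 (RE g) (acc.flatMap epT) el)
    (v : OctVertex) :
    linkChi g (Quotient.mk (vtxSetoid g) v) =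
      (nE vl (rootsR el el0) (getR vl (vcode v)) : ℤ) - (nV vl (getR vl (vcode v)) : ℤ) := by
  rw [linkChi, cornerCount_eq hf h hE, classSize_eq hf h]

theorem links_exists {g : Gluing} (hl : LinksGenusTwoTorus g) :
    (∃ v, linkChi g (Quotient.mk (vtxSetoid g) v) = 0) ∧
      ∃ v, linkChi g (Quotient.mk (vtxSetoid g) v) = -2 := by
  obtain ⟨-, h0, h2⟩ := hl
  rw [Nat.card_eq_one_iff_unique] at h0 h2
  obtain ⟨-, ⟨⟨c, hc⟩⟩⟩ := h0
  obtain ⟨-, ⟨⟨d, hd⟩⟩⟩ := h2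
  obtain ⟨v, rfl⟩ := Quotient.exists_rep c
  obtain ⟨w, rfl⟩ := Quotient.exists_rep d
  exact ⟨⟨v, hc⟩, ⟨w, hd⟩⟩

theorem links_linksR {g : Gluing} {acc : List (ℕ × ℕ × ℕ)} {vl el : List ℕ} (hf : Full g acc)
    (h : Lab 6 (RV g) (acc.flatMap vpT) vl) (hE : Lab 24 (RE g) (acc.flatMap epT) el)
    (hl : LinksGenusTwoTorus g) : linksR vl (rootsR el el0) = true := by
  obtain ⟨⟨v, hv⟩, ⟨w, hw⟩⟩ := links_exists hl
  rw [linkChi_eq hf h hE] at hv hw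
  have mem : ∀ v, getR vl (vcode v) ∈ vl := fun v => getR_mem _ _ (by rw [h.len]; exact vcode_lt v)
  have a1 : anyR vl (fun r => Nat.beq (nE vl (rootsR el el0) r) (nV vl r)) = true := by
    rw [anyR_iff]
    refine ⟨_, mem v, ?_⟩
    rw [Nat.beq_eq]; omega
  have a2 : anyR vl (fun r => Nat.beq (Nat.add (nE vl (rootsR el el0) r) 2) (nV vl r)) = true := by
    rw [anyR_iff]
    refine ⟨_, mem w, ?_⟩
    rw [Nat.beq_eq]
    show _ + 2 = _
    omega
  rw [linksR, a1, a2]; rfl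

theorem not_one {g : Gluing} {L : List (ℕ × ℕ)} {vl : List ℕ}
    (h : Lab 6 (RV g) L vl) (hl : LinksGenusTwoTorus g) : oneR vl ≠ true := by
  intro h1
  rw [oneR, allR_iff] at h1
  obtain ⟨⟨v, hv⟩, ⟨w, hw⟩⟩ := links_exists hl
  have mem : ∀ v, getR vl (vcode v) ∈ vl := fun v => getR_mem _ _ (by rw [h.len]; exact vcode_lt v)
  have e1 := h1 _ (mem v)
  have e2 := h1 _ (mem w)
  rw [Nat.beq_eq] at e1 e2
  have := h.sound _ (vcode_lt v) _ (vcode_lt w) (e1.trans e2.symm)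
  unfold RV at this
  rw [vdec_vcode, vdec_vcode, ← mk_vtx_iff] at this
  rw [this, hw] at hv
  norm_num at hv

theorem eqvR_sound {g h : Gluing} {T K : List ℕ} {acc : List (ℕ × ℕ × ℕ)} (hf : Full g acc)
    (hT : ∀ F, getR T (fcode F) = fcode (h.face F))
    (hK : ∀ F, getR K (fcode F) = pcode (h.axisMap F)) (hq : eqvR T K acc = true) :
    EquivGluing g h := by
  rw [eqvR, anyR_iff] at hq
  obtain ⟨r, hr, hq⟩ := hq
  rw [anyR_iff] at hq
  obtain ⟨e, he, hq⟩ := hq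
  obtain ⟨ρ, rfl⟩ := pcode_surj r hr
  obtain ⟨ε, rfl⟩ := fcode_surj e he
  rw [allR_iff] at hq
  have key : ∀ F, tri g F ∈ acc → h.face (symMapFace ρ ε F) = symMapFace ρ ε (g.face F) ∧
      h.axisMap (symMapFace ρ ε F) = ρ * g.axisMap F * ρ⁻¹ := by
    intro F hF
    have := hq _ hF
    simp only [chkR, tri, symR_eq, hT, hK, iteR_eq, Nat.beq_eq] at this
    split_ifs at this with h1
    refine ⟨fcode_inj _ _ h1, ?_⟩
    rw [conjR, allR_iff] at this
    have h3 : ∀ i : Fin 3, h.axisMap (symMapFace ρ ε F) (ρ i) = ρ (g.axisMap F i) := by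
      intro i
      have h4 := this i.val (by fin_cases i <;> simp)
      rw [Nat.beq_eq, pmR_eq, pmR_eq, pmR_eq, pmR_eq] at h4
      exact Fin.ext h4
    ext i
    have := h3 (ρ⁻¹ i)
    rw [show ρ (ρ⁻¹ i) = i by simp] at this
    rw [this]; rfl
  refine ⟨ρ, ε, ?_, ?_⟩
  · intro F
    rcases hf F with hF | hF
    · exact (key F hF).1
    · have := (key _ hF).1
      rw [gl_face_face] at this
      rw [← this, gl_face_face]
  · intro F
    rcases hf F with hF | hF
    · exact (key F hF).2
    · have h1 := (key _ hF).1
      have h2 := (key _ hF).2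
      rw [gl_face_face] at h1
      rw [← h1, gl_axis_face, h2, gl_axis_face]
      group

theorem search_sound (g : Gluing) (hl : LinksGenusTwoTorus g) (n : ℕ) :
    ∀ (rem : List ℕ) (acc : List (ℕ × ℕ × ℕ)) (vl el : List ℕ),
      rem.Nodup → (∀ a ∈ rem, ∃ F, fcode F = a) →
      (∀ F, fcode F ∈ rem → fcode (g.face F) ∈ rem) →
      (∀ F, fcode F ∈ rem ∨ tri g F ∈ acc ∨ tri g (g.face F) ∈ acc) →
      Lab 6 (RV g) (acc.flatMap vpT) vl → Lab 24 (RE g) (acc.flatMap epT) el →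
      searchR tabF tabA tabB n rem acc vl el = true →
      EquivGluing g gA ∨ EquivGluing g gB := by
  induction n with
  | zero =>
    intro rem acc vl el hnd hsur hcl hcov hV hE hs
    cases rem with
    | cons a t => exact absurd hs (by simp [searchR])
    | nil =>
      have hf : Full g acc := by
        intro F
        rcases hcov F with h | h
        · simp at h
        · exact h
      have hs : leafR tabF tabA tabB acc vl (rootsR el el0) = true := hs
      rw [leafR, links_linksR hf hV hE hl] at hs
      have hs : iteR (eqvR tabF tabA acc) true (eqvR tabF tabB acc) = true := hs
      rw [iteR_eq] at hs
      split_ifs at hs with h1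
      · exact Or.inl (eqvR_sound hf (by decide +kernel) (by decide +kernel) h1)
      · exact Or.inr (eqvR_sound hf (by decide +kernel) (by decide +kernel) hs)
  | succ n ih =>
    intro rem acc vl el hnd hsur hcl hcov hV hE hs
    cases rem with
    | nil => exact absurd hs (by simp [searchR])
    | cons a rest =>
      have hs : (allR rest fun b => allR (allowedR a b) fun k =>
        iteR (oneR (mergeAllR (vpR a b k) vl)) true
          (searchR tabF tabA tabB n (filR rest fun c => iteR (Nat.beq c b) false true)
            ((a, b, k) :: acc)
            (mergeAllR (vpR a b k) vl) (mergeAllR (epR a b k) el))) = true := hs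
      rw [allR_iff] at hs
      obtain ⟨F, rfl⟩ := hsur a (by simp)
      have hb : fcode (g.face F) ∈ rest := by
        rcases List.mem_cons.1 (hcl F (by simp)) with h | h
        · exact absurd (fcode_inj _ _ h) (g.2.2.1 F)
        · exact h
      have hs := hs _ hb
      rw [allR_iff] at hs
      have hs := hs (pcode (g.axisMap F)) (allowedR_mem _ _ _ (g.2.2.2.2 F))
      have hV' : Lab 6 (RV g) ((tri g F :: acc).flatMap vpT)
          (mergeAllR (vpR (fcode F) (fcode (g.face F)) (pcode (g.axisMap F))) vl) := by
        rw [List.flatMap_cons]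
        exact hV.mergeAll (RV_equiv g) _ (vpT_ok g F)
      have hE' : Lab 24 (RE g) ((tri g F :: acc).flatMap epT)
          (mergeAllR (epR (fcode F) (fcode (g.face F)) (pcode (g.axisMap F))) el) := by
        rw [List.flatMap_cons]
        exact hE.mergeAll (RE_equiv g) _ (epT_ok g F)
      rw [iteR_eq, if_neg (not_one hV' hl)] at hs
      have hfil : ∀ c, c ∈ filR rest (fun c => iteR (Nat.beq c (fcode (g.face F))) false true) ↔
          c ∈ rest ∧ c ≠ fcode (g.face F) := by
        intro c
        rw [filR_eq, List.mem_filter, iteR_eq]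
        simp
      have hnd' := List.nodup_cons.1 hnd
      refine ih _ _ _ _ ?_ ?_ ?_ ?_ hV' hE' hs
      · rw [filR_eq]; exact hnd'.2.filter _
      · intro c hc
        exact hsur c (List.mem_cons_of_mem _ ((hfil c).1 hc).1)
      · intro K hK
        obtain ⟨h1, h2⟩ := (hfil _).1 hK
        rw [hfil]
        rcases List.mem_cons.1 (hcl K (List.mem_cons_of_mem _ h1)) with h | h
        · exfalso
          apply h2
          rw [← fcode_inj _ _ h, gl_face_face]
        · refine ⟨h, fun h3 => ?_⟩
          have := g.face.injective (fcode_inj _ _ h3)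
          rw [this] at h1
          exact hnd'.1 h1
      · intro K
        rw [hfil]
        rcases hcov K with h | h | h
        · by_cases hKF : K = F
          · rw [hKF]; right; left; exact List.mem_cons_self
          · by_cases hKg : K = g.face F
            · right; right; rw [hKg, gl_face_face]; exact List.mem_cons_self
            · left
              refine ⟨?_, fun h3 => hKg (fcode_inj _ _ h3)⟩
              rcases List.mem_cons.1 h with h | h
              · exact absurd (fcode_inj _ _ h) hKF
              · exact h
        · right; left; exact List.mem_cons_of_mem _ h
        · right; right; exact List.mem_cons_of_mem _ h

theorem lab_vl0 (g : Gluing) : Lab 6 (RV g) [] vl0 := by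
  have hid : ∀ a < 6, getR vl0 a = a := by decide +kernel
  refine ⟨rfl, by simp, ?_, ?_, ?_, by simp⟩
  · intro a ha; rw [hid a ha]; exact ha
  · intro a ha; rw [hid a ha, hid a ha]
  · intro a ha b hb h
    rw [hid a ha, hid b hb] at h
    rw [h]; exact (RV_equiv g).refl _

theorem lab_el0 (g : Gluing) : Lab 24 (RE g) [] el0 := by
  have hid : ∀ a < 24, getR el0 a = a := by decide +kernel
  refine ⟨rfl, by simp, ?_, ?_, ?_, by simp⟩
  · intro a ha; rw [hid a ha]; exact ha
  · intro a ha; rw [hid a ha, hid a ha]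
  · intro a ha b hb h
    rw [hid a ha, hid b hb] at h
    rw [h]; exact (RE_equiv g).refl _

theorem classification (g : Gluing) (hl : LinksGenusTwoTorus g) :
    EquivGluing g gA ∨ EquivGluing g gB := by
  refine search_sound g hl 4 [0, 1, 2, 3, 4, 5, 6, 7] [] vl0 el0 (by decide) ?_ ?_ ?_ (lab_vl0 g) (lab_el0 g) search_true
  · exact fcode_surj
  · intro F _; exact fcode_mem _
  · intro F; exact Or.inl (fcode_mem F)

theorem card_one_of {g : Gluing} {n : ℤ} (v : OctVertex)
    (hv : linkChi g (Quotient.mk (vtxSetoid g) v) = n)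
    (hu : ∀ w, linkChi g (Quotient.mk (vtxSetoid g) w) = n →
      Quotient.mk (vtxSetoid g) w = Quotient.mk (vtxSetoid g) v) :
    Nat.card {c : Quotient (vtxSetoid g) // linkChi g c = n} = 1 := by
  rw [Nat.card_eq_one_iff_unique]
  refine ⟨⟨?_⟩, ⟨⟨_, hv⟩⟩⟩
  rintro ⟨c, hc⟩ ⟨d, hd⟩
  obtain ⟨w, rfl⟩ := Quotient.exists_rep c
  obtain ⟨w', rfl⟩ := Quotient.exists_rep d
  exact Subtype.ext ((hu w hc).trans (hu w' hd).symm)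

/-- Labels of the pattern computed from representatives of the face pairs. -/
def repFaces : List OctFace :=
  [![false, false, false], ![false, true, false], ![true, false, false], ![true, false, true]]

def vlOf (g : Gluing) : List ℕ := mergeAllR ((repFaces.map (tri g)).flatMap vpT) vl0
def elOf (g : Gluing) : List ℕ := mergeAllR ((repFaces.map (tri g)).flatMap epT) el0

theorem links_of (g : Gluing) (hf : ∀ F, tri g F ∈ repFaces.map (tri g) ∨
      tri g (g.face F) ∈ repFaces.map (tri g)) (A B : ℕ → ℕ)
    (hA : ∀ v : OctVertex, nE (vlOf g) (rootsR (elOf g) el0) (getR (vlOf g) (vcode v)) =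
      A (vcode v))
    (hB : ∀ v : OctVertex, nV (vlOf g) (getR (vlOf g) (vcode v)) = B (vcode v))
    (h1 : ∀ v : OctVertex, A (vcode v) = B (vcode v) + 2 ∨ A (vcode v) = B (vcode v) ∨
      A (vcode v) + 2 = B (vcode v))
    (v0 v2 : OctVertex) (h0 : A (vcode v0) = B (vcode v0))
    (h2 : A (vcode v2) + 2 = B (vcode v2))
    (u0 : ∀ w : OctVertex, A (vcode w) = B (vcode w) →
      getR (vlOf g) (vcode w) = getR (vlOf g) (vcode v0))
    (u2 : ∀ w : OctVertex, A (vcode w) + 2 = B (vcode w) →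
      getR (vlOf g) (vcode w) = getR (vlOf g) (vcode v2)) :
    LinksGenusTwoTorus g := by
  have hV : Lab 6 (RV g) ((repFaces.map (tri g)).flatMap vpT) (vlOf g) := by
    have := (lab_vl0 g).mergeAll (RV_equiv g) ((repFaces.map (tri g)).flatMap vpT) (by
      intro p hp
      obtain ⟨t, ht, hp⟩ := List.mem_flatMap.1 hp
      obtain ⟨F, -, rfl⟩ := List.mem_map.1 ht
      exact vpT_ok g F p hp)
    rwa [List.append_nil] at this
  have hE : Lab 24 (RE g) ((repFaces.map (tri g)).flatMap epT) (elOf g) := by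
    have := (lab_el0 g).mergeAll (RE_equiv g) ((repFaces.map (tri g)).flatMap epT) (by
      intro p hp
      obtain ⟨t, ht, hp⟩ := List.mem_flatMap.1 hp
      obtain ⟨F, -, rfl⟩ := List.mem_map.1 ht
      exact epT_ok g F p hp)
    rwa [List.append_nil] at this
  have hchi : ∀ v, linkChi g (Quotient.mk (vtxSetoid g) v) =
      (A (vcode v) : ℤ) - (B (vcode v) : ℤ) := by
    intro v
    rw [linkChi_eq hf hV hE, hA, hB]
  refine ⟨?_, card_one_of v0 ?_ ?_, card_one_of v2 ?_ ?_⟩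
  · intro c
    obtain ⟨v, rfl⟩ := Quotient.exists_rep c
    rw [hchi]
    have := h1 v
    omega
  · rw [hchi]; omega
  · intro w hw
    rw [hchi] at hw
    rw [mk_vtx_iff, ← labV_iff hf hV]
    exact u0 w (by omega)
  · rw [hchi]; omega
  · intro w hw
    rw [hchi] at hw
    rw [mk_vtx_iff, ← labV_iff hf hV]
    exact u2 w (by omega)

theorem links_gA : LinksGenusTwoTorus gA :=
  links_of gA (by decide +kernel) (fun n => if n = 1 then 1 else 3)
    (fun n => if n = 1 then 1 else 5) (by decide +kernel) (by decide +kernel) (by decide +kernel)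
    (0, true) (0, false) (by decide +kernel) (by decide +kernel) (by decide +kernel)
    (by decide +kernel)

theorem links_gB : LinksGenusTwoTorus gB :=
  links_of gB (by decide +kernel) (fun n => if n = 1 then 1 else 3)
    (fun n => if n = 1 then 1 else 5) (by decide +kernel) (by decide +kernel) (by decide +kernel)
    (0, true) (0, false) (by decide +kernel) (by decide +kernel) (by decide +kernel)
    (by decide +kernel)

end

end Classification

/-- there are exactly `2` combinatorially inequivalent orientation-reversing
gluing patterns of the octahedron whose non-sphere vertex-link data consists of one
genus-2 surface and one torus, and their quotient spaces are not homeomorphic: two such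
patterns with homeomorphic quotient spaces are combinatorially equivalent. -/
theorem genus_two_torus_gluings_distinct :
    Nat.card {s : Set Gluing // ∃ g : Gluing, LinksGenusTwoTorus g ∧ s = orbit g} = 2 ∧
    ∀ g h : Gluing, LinksGenusTwoTorus g → LinksGenusTwoTorus h →
      Nonempty (XSpace g ≃ₜ XSpace h) → EquivGluing g h := by
  exact main_of_classification links_gA links_gB classification
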